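/- arXiv:2104.13862 — 11 statements merged into one kernel-verified Lean document; each statement's English description precedes it below -/
import Mathlib

section
/- A finite lattice L is planar if and only if there exists a strict order on L complementary to the lattice order of L. -/
/-- A finite lattice is *planar* if it has a planar diagram: an injective placement of its
elements in `ℝ²` that is `y`-isotone on coverings, has the noninterference property, and whose
distinct covering segments intersect only in common endpoints. -/
def IsPlanarLattice (L : Type*) [Lattice L] [Finite L] : Prop :=
  ∃ f : L → ℝ × ℝ,
    Function.Injective f ∧
    (∀ p q : L, p ⋖ q → (f p).2 < (f q).2) ∧
    (∀ p q : L, p ⋖ q → ∀ r : L, f r ∈ segment ℝ (f p) (f q) → f r = f p ∨ f r = f q) ∧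
    (∀ p q p' q' : L, p ⋖ q → p' ⋖ q' → (p, q) ≠ (p', q') →
      segment ℝ (f p) (f q) ∩ segment ℝ (f p') (f q') ⊆
        ({f p, f q} ∩ {f p', f q'} : Set (ℝ × ℝ)))

/-- `r` is a strict order: irreflexive and transitive. -/
def IsStrictOrderRel {P : Type*} (r : P → P → Prop) : Prop :=
  (∀ a, ¬ r a a) ∧ ∀ a b c, r a b → r b c → r a c

/-- `lam` is complementary to `lt`: any two distinct elements are related (in one direction
or the other) by exactly one of `lt` and `lam`. -/
def ComplementaryTo {P : Type*} (lt lam : P → P → Prop) : Prop :=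
  ∀ a b : P, a ≠ b → Xor' (lt a b ∨ lt b a) (lam a b ∨ lam b a)

namespace Zilber

/-! ### From a complementary order to a diagram -/

theorem exists_rank {L : Type*} [Lattice L] [Finite L] (lam : L → L → Prop)
    (h1 : IsStrictOrderRel lam) (h2 : ComplementaryTo (· < · : L → L → Prop) lam) :
    ∃ a : L → ℝ, ∀ p q, (p < q ∨ lam p q) → a p < a q := by
  obtain ⟨hirr, htr⟩ := h1
  have hex : ∀ p q, p < q → ¬ lam p q ∧ ¬ lam q p := by
    intro p q h
    have := h2 p q h.ne
    simp only [Xor', Xor] at this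
    tauto
  have htot : ∀ p q, p ≠ q → p < q ∨ q < p ∨ lam p q ∨ lam q p := by
    intro p q h
    have := h2 p q h
    simp only [Xor', Xor] at this
    tauto
  have key : ∀ p q r, (p < q ∨ lam p q) → (q < r ∨ lam q r) → (p < r ∨ lam p r) := by
    intro p q r hpq hqr
    rcases hpq with hpq | hpq <;> rcases hqr with hqr | hqr
    · exact Or.inl (hpq.trans hqr)
    · by_cases hpr : p = r
      · subst hpr; exact absurd hqr (hex _ _ hpq).2
      · rcases htot p r hpr with h | h | h | h
        · exact Or.inl h
        · exact absurd hqr (hex _ _ (h.trans hpq)).2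
        · exact Or.inr h
        · exact absurd (htr _ _ _ hqr h) (hex _ _ hpq).2
    · by_cases hpr : p = r
      · subst hpr; exact absurd hpq (hex _ _ hqr).2
      · rcases htot p r hpr with h | h | h | h
        · exact Or.inl h
        · exact absurd hpq (hex _ _ (hqr.trans h)).2
        · exact Or.inr h
        · exact absurd (htr _ _ _ h hpq) (hex _ _ hqr).2
    · exact Or.inr (htr _ _ _ hpq hqr)
  refine ⟨fun p => (({r | r < p ∨ lam r p} : Set L).ncard : ℝ), fun p q h => ?_⟩
  have : ({r | r < p ∨ lam r p} : Set L).ncard < ({r | r < q ∨ lam r q} : Set L).ncard := by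
    apply Set.ncard_lt_ncard _ (Set.toFinite _)
    refine ⟨fun r hr => key _ _ _ hr h, fun hsub => ?_⟩
    have hp : p < p ∨ lam p p := hsub h
    rcases hp with hp | hp
    · exact lt_irrefl _ hp
    · exact hirr _ hp
  simp only
  exact_mod_cast this

theorem seg_bounds {u v w : ℝ × ℝ} (h : w ∈ segment ℝ u v) (h1 : u.1 ≤ v.1)
    (h2 : u.2 - u.1 ≤ v.2 - v.1) :
    u.1 ≤ w.1 ∧ w.1 ≤ v.1 ∧ u.2 - u.1 ≤ w.2 - w.1 ∧ w.2 - w.1 ≤ v.2 - v.1 := by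
  obtain ⟨a, b, ha, hb, hab, rfl⟩ := h
  obtain rfl : a = 1 - b := by linarith
  simp only [Prod.fst_add, Prod.snd_add, Prod.smul_fst, Prod.smul_snd, smul_eq_mul]
  refine ⟨?_, ?_, ?_, ?_⟩ <;> nlinarith

/-- two segments sharing an endpoint `u` and another point are comparable -/
theorem seg_collinear {u v v' w : ℝ × ℝ} (h : w ∈ segment ℝ u v) (h' : w ∈ segment ℝ u v')
    (hw : w ≠ u) : ∃ c : ℝ, 0 < c ∧ v - u = c • (v' - u) := by
  rw [segment_eq_image'] at h h'
  obtain ⟨s, ⟨hs0, hs1⟩, hs⟩ := h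
  obtain ⟨t, ⟨ht0, ht1⟩, ht⟩ := h'
  simp only at hs ht
  have hs' : s ≠ 0 := by rintro rfl; apply hw; rw [← hs]; simp
  have ht' : t ≠ 0 := by rintro rfl; apply hw; rw [← ht]; simp
  refine ⟨s⁻¹ * t, by positivity, ?_⟩
  have : s • (v - u) = t • (v' - u) := by
    rw [← ht] at hs
    exact add_left_cancel hs
  rw [mul_smul, ← this, smul_smul, inv_mul_cancel₀ hs', one_smul]

theorem backward {L : Type*} [Lattice L] [Finite L] (lam : L → L → Prop)
    (h1 : IsStrictOrderRel lam) (h2 : ComplementaryTo (· < · : L → L → Prop) lam) :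
    IsPlanarLattice L := by
  obtain ⟨a, ha⟩ := exists_rank lam h1 h2
  obtain ⟨b, hb⟩ := exists_rank (fun x y => lam y x)
    ⟨fun x => h1.1 x, fun x y z hxy hyz => h1.2 _ _ _ hyz hxy⟩
    (fun x y hxy => by
      have := h2 x y hxy
      simp only [Xor', Xor] at this ⊢
      tauto)
  have htot : ∀ p q, p ≠ q → p < q ∨ q < p ∨ lam p q ∨ lam q p := by
    intro p q h
    have := h2 p q h
    simp only [Xor', Xor] at this
    tauto
  have hle : ∀ p q, a p ≤ a q → b p ≤ b q → p ≤ q := by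
    intro p q h h'
    by_cases hpq : p = q
    · exact hpq.le
    rcases htot p q hpq with h3 | h3 | h3 | h3
    · exact h3.le
    · exact absurd (ha _ _ (Or.inl h3)) (not_lt.2 h)
    · exact absurd (hb _ _ (Or.inr h3)) (not_lt.2 h')
    · exact absurd (ha _ _ (Or.inr h3)) (not_lt.2 h)
  obtain ⟨f, hf⟩ : ∃ f : L → ℝ × ℝ, ∀ p, f p = (a p, a p + b p) := ⟨_, fun _ => rfl⟩
  have hf1 : ∀ p, (f p).1 = a p := fun p => by rw [hf]
  have hf2 : ∀ p, (f p).2 - (f p).1 = b p := fun p => by rw [hf]; simp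
  have hsb : ∀ p q, p ⋖ q → ∀ w ∈ segment ℝ (f p) (f q),
      a p ≤ w.1 ∧ w.1 ≤ a q ∧ b p ≤ w.2 - w.1 ∧ w.2 - w.1 ≤ b q := by
    intro p q hpq w hw
    have := seg_bounds hw (by rw [hf1, hf1]; exact (ha _ _ (Or.inl hpq.lt)).le)
      (by rw [hf2, hf2]; exact (hb _ _ (Or.inl hpq.lt)).le)
    rwa [hf2, hf2, hf1, hf1] at this
  have hext : ∀ p (w : ℝ × ℝ), w.1 = a p → w.2 - w.1 = b p → w = f p := by
    intro p w h h'
    rw [hf]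
    ext <;> simp <;> linarith
  have hmid : ∀ p q m : L, p ⋖ q → p ≤ m → m ≤ q → m = p ∨ m = q := by
    intro p q m h h' h''
    exact h.eq_or_eq h' h''
  refine ⟨f, ?_, ?_, ?_, ?_⟩
  · intro p q h
    have e1 : a p = a q := by rw [← hf1, h, hf1]
    have e2 : b p = b q := by rw [← hf2, h, hf2]
    exact le_antisymm (hle _ _ e1.le e2.le) (hle _ _ e1.ge e2.ge)
  · intro p q hpq
    have e1 := ha _ _ (Or.inl hpq.lt)
    have e2 := hb _ _ (Or.inl hpq.lt)
    rw [hf, hf]; simp only; linarith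
  · intro p q hpq r hr
    obtain ⟨e1, e2, e3, e4⟩ := hsb p q hpq _ hr
    rw [hf1] at e1 e2
    rw [hf2] at e3 e4
    rcases hmid p q r hpq (hle _ _ e1 e3) (hle _ _ e2 e4) with h | h
    · left; rw [h]
    · right; rw [h]
  · rintro p q p' q' hpq hpq' hne w ⟨hw, hw'⟩
    obtain ⟨e1, e2, e3, e4⟩ := hsb p q hpq _ hw
    obtain ⟨e1', e2', e3', e4'⟩ := hsb p' q' hpq' _ hw'
    have k1 : p ≤ q' := hle _ _ (e1.trans e2') (e3.trans e4')
    have k2 : p' ≤ q := hle _ _ (e1'.trans e2) (e3'.trans e4)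
    have hm1 := hmid p q (p ⊔ p') hpq le_sup_left (sup_le hpq.le k2)
    have hm2 := hmid p' q' (p ⊔ p') hpq' le_sup_right (sup_le k1 hpq'.le)
    rcases hm1 with hm1 | hm1 <;> rcases hm2 with hm2 | hm2
    · have hpp : p = p' := hm1.symm.trans hm2
      subst hpp
      by_cases hwu : w = f p
      · subst hwu; simp
      exfalso
      obtain ⟨c, hc, hcv⟩ := seg_collinear hw hw' hwu
      have c1 : a q - a p = c * (a q' - a p) := by
        have := congrArg Prod.fst hcv
        simpa [hf] using this
      have c2 : b q - b p = c * (b q' - b p) := by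
        have := congrArg Prod.snd hcv
        simp [hf] at this
        linarith
      have a1 := ha _ _ (Or.inl hpq'.lt)
      have a2 := hb _ _ (Or.inl hpq'.lt)
      have : q = q' := by
        rcases le_total c 1 with h | h
        · have : q ≤ q' := hle _ _ (by nlinarith) (by nlinarith)
          rcases hmid p q' q hpq' hpq.le this with h | h
          · exact absurd h hpq.ne'
          · exact h
        · have : q' ≤ q := hle _ _ (by nlinarith) (by nlinarith)
          rcases hmid p q q' hpq hpq'.le this with h | h
          · exact absurd h hpq'.ne'
          · exact h.symm
      exact hne (by rw [this])
    · have hpp : p = q' := hm1.symm.trans hm2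
      subst hpp
      have : w = f p := hext _ _ (le_antisymm e2' e1) (le_antisymm e4' e3)
      subst this; simp
    · have hpp : q = p' := hm1.symm.trans hm2
      subst hpp
      have : w = f q := hext _ _ (le_antisymm e2 e1') (le_antisymm e4 e3')
      subst this; simp
    · have hpp : q = q' := hm1.symm.trans hm2
      subst hpp
      by_cases hwu : w = f q
      · subst hwu; simp
      exfalso
      rw [segment_symm] at hw hw'
      obtain ⟨c, hc, hcv⟩ := seg_collinear hw hw' hwu
      have c1 : a p - a q = c * (a p' - a q) := by
        have := congrArg Prod.fst hcv
        simpa [hf] using this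
      have c2 : b p - b q = c * (b p' - b q) := by
        have := congrArg Prod.snd hcv
        simp [hf] at this
        linarith
      have a1 := ha _ _ (Or.inl hpq'.lt)
      have a2 := hb _ _ (Or.inl hpq'.lt)
      have : p = p' := by
        rcases le_total c 1 with h | h
        · have : p' ≤ p := hle _ _ (by nlinarith) (by nlinarith)
          rcases hmid p' q p hpq' this hpq.le with h | h
          · exact h
          · exact absurd h hpq.ne
        · have : p ≤ p' := hle _ _ (by nlinarith) (by nlinarith)
          rcases hmid p q p' hpq this hpq'.le with h | h
          · exact h.symm
          · exact absurd h hpq'.ne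
      exact hne (by rw [this])

/-! ### From a diagram to a complementary order -/

/-- `g` is the curve (as a function of the height) of the saturated chain `S` from `a` to `b`. -/
structure IsPath {L : Type*} [Lattice L] (f : L → ℝ × ℝ) (a b : L) (S : Set L) (g : ℝ → ℝ) :
    Prop where
  memL : a ∈ S
  memR : b ∈ S
  bdd : ∀ c ∈ S, a ≤ c ∧ c ≤ b
  chain : ∀ c ∈ S, ∀ d ∈ S, c ≤ d ∨ d ≤ c
  cont : ContinuousOn g (Set.Icc (f a).2 (f b).2)
  val : ∀ c ∈ S, g (f c).2 = (f c).1
  seg : ∀ t ∈ Set.Icc (f a).2 (f b).2, ∃ p ∈ S, ∃ q ∈ S, p ⩿ q ∧ (g t, t) ∈ segment ℝ (f p) (f q)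

variable {L : Type*} [Lattice L] {f : L → ℝ × ℝ}

theorem IsPath.refl (f : L → ℝ × ℝ) (a : L) : IsPath f a a {a} (fun _ => (f a).1) where
  memL := rfl
  memR := rfl
  bdd := by rintro c rfl; simp
  chain := by rintro c rfl d rfl; simp
  cont := continuousOn_const
  val := by rintro c rfl; rfl
  seg := by
    rintro t ⟨h1, h2⟩
    obtain rfl : t = (f a).2 := le_antisymm h2 h1
    exact ⟨a, rfl, a, rfl, WCovBy.refl a, by simp⟩

theorem IsPath.edge {a b : L} (hab : a ⋖ b) (hY : (f a).2 < (f b).2) :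
    ∃ g, IsPath f a b {a, b} g := by
  have hd : (f b).2 - (f a).2 ≠ 0 := by linarith
  have hd' : 0 < (f b).2 - (f a).2 := by linarith
  refine ⟨fun t => (f a).1 + (t - (f a).2) / ((f b).2 - (f a).2) * ((f b).1 - (f a).1), ?_⟩
  refine ⟨by simp, by simp, ?_, ?_, ?_, ?_, ?_⟩
  · have := hab.le
    rintro c (rfl | rfl) <;> simp [this]
  · have := hab.le
    rintro c (rfl | rfl) d (rfl | rfl) <;> simp [this]
  · fun_prop
  · rintro c (rfl | rfl)
    · simp
    · field_simp; ring
  · rintro t ⟨h1, h2⟩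
    refine ⟨a, by simp, b, by simp, hab.wcovBy, ?_⟩
    rw [segment_eq_image']
    refine ⟨(t - (f a).2) / ((f b).2 - (f a).2), ⟨by apply div_nonneg <;> linarith, ?_⟩, ?_⟩
    · rw [div_le_one hd']; linarith
    · ext
      · simp
      · simp; field_simp; ring

theorem IsPath.trans (hY : StrictMono (fun x => (f x).2)) {a b c : L} {S T : Set L} {g h : ℝ → ℝ}
    (hg : IsPath f a b S g) (hh : IsPath f b c T h) :
    IsPath f a c (S ∪ T) (fun t => if t ≤ (f b).2 then g t else h t) := by
  have hab := (hg.bdd b hg.memR).1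
  have hbc := (hh.bdd b hh.memL).2
  have hgh : g (f b).2 = h (f b).2 := by rw [hg.val b hg.memR, hh.val b hh.memL]
  have Yab : (f a).2 ≤ (f b).2 := hY.monotone hab
  have Ybc : (f b).2 ≤ (f c).2 := hY.monotone hbc
  have e1 : Set.EqOn (fun t => if t ≤ (f b).2 then g t else h t) g (Set.Icc (f a).2 (f b).2) := by
    intro t ht
    simp [ht.2]
  have e2 : Set.EqOn (fun t => if t ≤ (f b).2 then g t else h t) h (Set.Icc (f b).2 (f c).2) := by
    intro t ht
    by_cases h' : t ≤ (f b).2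
    · obtain rfl : t = (f b).2 := le_antisymm h' ht.1
      simp [hgh]
    · simp [h']
  refine ⟨Or.inl hg.memL, Or.inr hh.memR, ?_, ?_, ?_, ?_, ?_⟩
  · rintro d (hd | hd)
    · exact ⟨(hg.bdd d hd).1, (hg.bdd d hd).2.trans hbc⟩
    · exact ⟨hab.trans (hh.bdd d hd).1, (hh.bdd d hd).2⟩
  · rintro d (hd | hd) e (he | he)
    · exact hg.chain d hd e he
    · exact Or.inl ((hg.bdd d hd).2.trans (hh.bdd e he).1)
    · exact Or.inr ((hg.bdd e he).2.trans (hh.bdd d hd).1)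
    · exact hh.chain d hd e he
  · rw [← Set.Icc_union_Icc_eq_Icc Yab Ybc]
    exact (hg.cont.congr e1).union_of_isClosed (hh.cont.congr e2) isClosed_Icc isClosed_Icc
  · rintro d (hd | hd)
    · exact (e1 ⟨hY.monotone (hg.bdd d hd).1, hY.monotone (hg.bdd d hd).2⟩).trans (hg.val d hd)
    · exact (e2 ⟨hY.monotone (hh.bdd d hd).1, hY.monotone (hh.bdd d hd).2⟩).trans (hh.val d hd)
  · rintro t ⟨h1, h2⟩
    rcases le_total t (f b).2 with ht | ht
    · obtain ⟨p, hp, q, hq, hpq, hs⟩ := hg.seg t ⟨h1, ht⟩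
      exact ⟨p, Or.inl hp, q, Or.inl hq, hpq, by
        have e := e1 ⟨h1, ht⟩
        simp only at e
        rw [e]; exact hs⟩
    · obtain ⟨p, hp, q, hq, hpq, hs⟩ := hh.seg t ⟨ht, h2⟩
      exact ⟨p, Or.inr hp, q, Or.inr hq, hpq, by
        have e := e2 ⟨ht, h2⟩
        simp only at e
        rw [e]; exact hs⟩

theorem exists_path [Finite L] (hY : StrictMono (fun x => (f x).2)) (b : L) :
    ∀ a : L, a ≤ b → ∃ S g, IsPath f a b S g := by
  intro a
  induction a using (wellFounded_gt (α := L)).induction with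
  | _ a ih =>
    intro hab
    rcases hab.eq_or_lt with rfl | hlt
    · exact ⟨_, _, IsPath.refl f a⟩
    · obtain ⟨c, hac, hcb⟩ := exists_covBy_le_of_lt hlt
      obtain ⟨S, g, hg⟩ := ih c hac.lt hcb
      obtain ⟨g', hg'⟩ := IsPath.edge (f := f) hac (hY hac.lt)
      exact ⟨_, _, hg'.trans hY hg⟩

theorem seg_height {u v w : ℝ × ℝ} (h : w ∈ segment ℝ u v) (h2 : u.2 ≤ v.2) :
    u.2 ≤ w.2 ∧ w.2 ≤ v.2 := by
  obtain ⟨a, b, ha, hb, hab, rfl⟩ := h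
  obtain rfl : a = 1 - b := by linarith
  simp only [Prod.snd_add, Prod.smul_snd, smul_eq_mul]
  constructor <;> nlinarith

/-- Crossing lemma: if the curves of two chains meet at a height between `x` and `z`, where `x`
is on the first one and `z` on the second, then `x ≤ z`. -/
theorem le_of_meet (hinj : Function.Injective f) (hY : StrictMono (fun x => (f x).2))
    (hni : ∀ p q : L, p ⋖ q → ∀ r : L, f r ∈ segment ℝ (f p) (f q) → f r = f p ∨ f r = f q)
    (hpl : ∀ p q p' q' : L, p ⋖ q → p' ⋖ q' → (p, q) ≠ (p', q') →
      segment ℝ (f p) (f q) ∩ segment ℝ (f p') (f q') ⊆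
        ({f p, f q} ∩ {f p', f q'} : Set (ℝ × ℝ)))
    {a b a' b' : L} {S T : Set L} {g h : ℝ → ℝ}
    (hg : IsPath f a b S g) (hh : IsPath f a' b' T h) {x z : L} (hx : x ∈ S) (hz : z ∈ T)
    {t : ℝ} (ht : t ∈ Set.Icc (f x).2 (f z).2) (htg : t ∈ Set.Icc (f a).2 (f b).2)
    (hth : t ∈ Set.Icc (f a').2 (f b').2) (heq : g t = h t) : x ≤ z := by
  obtain ⟨p, hp, q, hq, hpq, hs⟩ := hg.seg t htg
  obtain ⟨p', hp', q', hq', hpq', hs'⟩ := hh.seg t hth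
  rw [← heq] at hs'
  have key : ∀ e ∈ S, e ∈ T → (g t, t) = f e → x ≤ z := by
    intro e heS heT he
    have het : (f e).2 = t := by rw [← he]
    have h1 : x ≤ e := by
      rcases hg.chain x hx e heS with h | h
      · exact h
      · rcases h.eq_or_lt with h | h
        · exact h.ge
        · have := hY h
          simp only at this
          have := ht.1
          linarith
    have h2 : e ≤ z := by
      rcases hh.chain e heT z hz with h | h
      · exact h
      · rcases h.eq_or_lt with h | h
        · exact h.ge
        · have := hY h
          simp only at this
          have := ht.2
          linarith
    exact h1.trans h2
  rcases wcovBy_iff_covBy_or_eq.1 hpq with hc | rfl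
  · rcases wcovBy_iff_covBy_or_eq.1 hpq' with hc' | rfl
    · by_cases hne : (p, q) = (p', q')
      · obtain ⟨rfl, rfl⟩ := Prod.mk.inj hne
        obtain ⟨b1, b2⟩ := seg_height hs (hY hc.lt).le
        simp only at b1 b2
        rcases hg.chain x hx p hp with hxp | hxp
        · rcases hh.chain p hp' z hz with hzp | hzp
          · exact hxp.trans hzp
          · rcases hzp.eq_or_lt with h | h
            · exact hxp.trans h.ge
            · have := hY h
              simp only at this
              have := ht.2
              linarith
        · rcases hxp.eq_or_lt with h | hxp
          · subst h
            rcases hh.chain p hp' z hz with hzp | hzp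
            · exact hzp
            · rcases hzp.eq_or_lt with h | h
              · exact h.ge
              · have := hY h
                simp only at this
                have := ht.2
                linarith
          have hqx : q ≤ x := by
            rcases hg.chain x hx q hq with h | h
            · rcases hc.eq_or_eq hxp.le h with h' | h'
              · exact absurd h' hxp.ne'
              · exact h'.ge
            · exact h
          rcases hqx.eq_or_lt with h | h
          · subst h
            rcases hh.chain q hq' z hz with hzp | hzp
            · exact hzp
            · rcases hzp.eq_or_lt with h | h
              · exact h.ge
              · have := hY h
                simp only at this
                have := ht.2
                have := ht.1
                linarith
          · have := hY h
            simp only at this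
            have := ht.1
            linarith
      · obtain ⟨h1, h2⟩ := hpl p q p' q' hc hc' hne ⟨hs, hs'⟩
        rcases h1 with h1 | h1 <;> rcases h2 with h2 | h2
        · exact key p hp (by rwa [hinj (h1.symm.trans h2)]) h1
        · exact key p hp (by rwa [hinj (h1.symm.trans h2)]) h1
        · exact key q hq (by rwa [hinj (h1.symm.trans h2)]) h1
        · exact key q hq (by rwa [hinj (h1.symm.trans h2)]) h1
    · rw [segment_same] at hs'
      have hs'' : (g t, t) = f p' := hs'
      rw [hs''] at hs
      rcases hni p q hc p' hs with h | h
      · exact key p' (by rwa [hinj h]) hp' hs''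
      · exact key p' (by rwa [hinj h]) hp' hs''
  · rw [segment_same] at hs
    have hs'' : (g t, t) = f p := hs
    rcases wcovBy_iff_covBy_or_eq.1 hpq' with hc' | rfl
    · rw [hs''] at hs'
      rcases hni p' q' hc' p hs' with h | h
      · exact key p hp (by rwa [hinj h]) hs''
      · exact key p hp (by rwa [hinj h]) hs''
    · rw [segment_same] at hs'
      have hs3 : (g t, t) = f p' := hs'
      exact key p hp (by rwa [hinj (hs''.symm.trans hs3)]) hs''

theorem exists_meet {g h : ℝ → ℝ} {A B s t : ℝ} (hg : ContinuousOn g (Set.Icc A B))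
    (hh : ContinuousOn h (Set.Icc A B)) (hs : s ∈ Set.Icc A B) (ht : t ∈ Set.Icc A B)
    (hst : s ≤ t) (h1 : g s ≤ h s) (h2 : h t ≤ g t) : ∃ r ∈ Set.Icc s t, g r = h r := by
  have hsub : Set.Icc s t ⊆ Set.Icc A B := Set.Icc_subset_Icc hs.1 ht.2
  have := intermediate_value_Icc hst ((hg.mono hsub).sub (hh.mono hsub))
  obtain ⟨r, hr, hr'⟩ := this (show (0 : ℝ) ∈ Set.Icc _ _ from ⟨by simpa using h1, by simpa using h2⟩)
  exact ⟨r, hr, by simpa [sub_eq_zero] using hr'⟩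

theorem forward [Finite L] (hL : IsPlanarLattice L) :
    ∃ lam : L → L → Prop,
      IsStrictOrderRel lam ∧ ComplementaryTo (· < · : L → L → Prop) lam := by
  rcases isEmpty_or_nonempty L with hE | hN
  · exact ⟨fun _ _ => False, ⟨fun a => (hE.false a).elim, fun a => (hE.false a).elim⟩,
      fun a => (hE.false a).elim⟩
  obtain ⟨f, hinj, hcov, hni, hpl⟩ := hL
  obtain ⟨bot, hbot⟩ : ∃ bot : L, ∀ x, bot ≤ x := by
    obtain ⟨m, -, hm⟩ := (wellFounded_lt (α := L)).has_min Set.univ Set.univ_nonempty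
    refine ⟨m, fun x => ?_⟩
    have h : m ⊓ x = m := eq_of_le_of_not_lt inf_le_left (hm _ trivial)
    exact inf_eq_left.1 h
  obtain ⟨top, htop⟩ : ∃ top : L, ∀ x, x ≤ top := by
    obtain ⟨m, -, hm⟩ := (wellFounded_gt (α := L)).has_min Set.univ Set.univ_nonempty
    refine ⟨m, fun x => ?_⟩
    have h : m = m ⊔ x := eq_of_le_of_not_lt le_sup_left (hm _ trivial)
    exact sup_eq_left.1 h.symm
  have hY : StrictMono (fun x => (f x).2) := by
    intro a b
    induction a using (wellFounded_gt (α := L)).induction with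
    | _ a ih =>
      intro hlt
      obtain ⟨c, hac, hcb⟩ := exists_covBy_le_of_lt hlt
      rcases hcb.eq_or_lt with rfl | h
      · exact hcov _ _ hac
      · exact (hcov _ _ hac).trans (ih c hac.lt h)
  have hmem : ∀ x, (f x).2 ∈ Set.Icc (f bot).2 (f top).2 := fun x =>
    ⟨hY.monotone (hbot x), hY.monotone (htop x)⟩
  have hthrough : ∀ x z, x ≤ z → ∃ S g, IsPath f bot top S g ∧ x ∈ S ∧ z ∈ S := by
    intro x z hxz
    obtain ⟨S1, g1, h1⟩ := exists_path hY x bot (hbot x)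
    obtain ⟨S2, g2, h2⟩ := exists_path hY z x hxz
    obtain ⟨S3, g3, h3⟩ := exists_path hY top z (htop z)
    exact ⟨_, _, (h1.trans hY h2).trans hY h3, Or.inl (Or.inl h1.memR), Or.inr h3.memL⟩
  have hch : ∀ x, ∃ S g, IsPath f bot top S g ∧ x ∈ S := by
    intro x
    obtain ⟨S, g, h, hx, _⟩ := hthrough x x le_rfl
    exact ⟨S, g, h, hx⟩
  choose S g hP hS using hch
  have hval : ∀ x, g x (f x).2 = (f x).1 := fun x => (hP x).val x (hS x)
  -- crossing at height r
  have meet : ∀ {S T : Set L} {g h : ℝ → ℝ}, IsPath f bot top S g → IsPath f bot top T h →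
      ∀ {x z : L}, x ∈ S → z ∈ T → ∀ {r : ℝ}, (f x).2 ≤ r → r ≤ (f z).2 → g r = h r → x ≤ z := by
    intro S T g h hg hh x z hx hz r h1 h2 he
    have hr : r ∈ Set.Icc (f bot).2 (f top).2 := ⟨(hmem x).1.trans h1, h2.trans (hmem z).2⟩
    exact le_of_meet hinj hY hni hpl hg hh hx hz ⟨h1, h2⟩ hr hr he
  have cross : ∀ {S T : Set L} {g h : ℝ → ℝ}, IsPath f bot top S g → IsPath f bot top T h →
      ∀ {x z : L}, (f x).2 ≤ (f z).2 → g (f x).2 ≤ h (f x).2 → h (f z).2 ≤ g (f z).2 →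
      ∃ r, (f x).2 ≤ r ∧ r ≤ (f z).2 ∧ g r = h r := by
    intro S T g h hg hh x z hxz h1 h2
    obtain ⟨r, hr, he⟩ := exists_meet hg.cont hh.cont (hmem x) (hmem z) hxz h1 h2
    exact ⟨r, hr.1, hr.2, he⟩
  -- the side of x with respect to the chain of y is strict
  have hne : ∀ x y, ¬ x ≤ y → ¬ y ≤ x → (f x).1 ≠ g y (f x).2 := by
    intro x y h1 h2 he
    rcases le_total (f x).2 (f y).2 with h | h
    · exact h1 (meet (hP x) (hP y) (hS x) (hS y) le_rfl h (by rw [hval, he]))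
    · exact h2 (meet (hP y) (hP x) (hS y) (hS x) h le_rfl (by rw [hval, he]))
  have hasymm0 : ∀ x y, ¬ x ≤ y → (f x).2 ≤ (f y).2 →
      ((f x).1 < g y (f x).2 ↔ ¬ (f y).1 < g x (f y).2) ∨ y ≤ x := by
    intro x y h1 hxy
    by_cases h2 : y ≤ x
    · exact Or.inr h2
    left
    have n1 := hne x y h1 h2
    have n2 := hne y x h2 h1
    constructor
    · intro hl hl'
      obtain ⟨r, r1, r2, he⟩ := cross (hP x) (hP y) hxy (by rw [hval]; exact hl.le)
        (by rw [hval]; exact hl'.le)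
      exact h1 (meet (hP x) (hP y) (hS x) (hS y) r1 r2 he)
    · intro hl
      by_contra hl'
      obtain ⟨r, r1, r2, he⟩ := cross (hP y) (hP x) hxy (by rw [hval]; exact not_lt.1 hl')
        (by rw [hval]; exact not_lt.1 hl)
      exact h1 (meet (hP x) (hP y) (hS x) (hS y) r1 r2 he.symm)
  have hasymm : ∀ x y, ¬ x ≤ y → ¬ y ≤ x →
      ((f x).1 < g y (f x).2 ↔ ¬ (f y).1 < g x (f y).2) := by
    intro x y h1 h2
    rcases le_total (f x).2 (f y).2 with h | h
    · exact (hasymm0 x y h1 h).resolve_right h2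
    · have := (hasymm0 y x h2 h).resolve_right h1
      tauto
  obtain ⟨lam, hlam⟩ : ∃ lam : L → L → Prop, ∀ x y,
      lam x y ↔ (¬ x ≤ y ∧ ¬ y ≤ x ∧ (f x).1 < g y (f x).2) := ⟨_, fun _ _ => Iff.rfl⟩
  have hlam' : ∀ x y, lam x y → g x (f y).2 < (f y).1 := by
    intro x y h
    obtain ⟨h1, h2, h3⟩ := (hlam x y).1 h
    have := (hasymm x y h1 h2).1 h3
    exact lt_of_le_of_ne (not_lt.1 this) (hne y x h2 h1).symm
  -- no cycle of length three, middle height case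
  have cyc : ∀ x y z, lam x y → lam y z → lam z x →
      ((f x).2 ≤ (f y).2 ∧ (f y).2 ≤ (f z).2) ∨ ((f z).2 ≤ (f y).2 ∧ (f y).2 ≤ (f x).2) →
      False := by
    intro x y z hxy hyz hzx hcase
    have k1 := hlam' x y hxy
    have k2 := ((hlam y z).1 hyz).2.2
    obtain ⟨n1, n2, k3⟩ := (hlam z x).1 hzx
    have k4 := hlam' z x hzx
    rcases hcase with ⟨h1, h2⟩ | ⟨h1, h2⟩
    · obtain ⟨r, r1, r2, he⟩ := cross (hP z) (hP x) h1 (by rw [hval]; exact k4.le)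
        (k1.trans k2).le
      exact n2 (meet (hP x) (hP z) (hS x) (hS z) r1 (r2.trans h2) he.symm)
    · obtain ⟨r, r1, r2, he⟩ := cross (hP z) (hP x) h1 (by rw [hval]; exact k3.le)
        (k1.trans k2).le
      exact n1 (meet (hP z) (hP x) (hS z) (hS x) r1 (r2.trans h2) he)
  refine ⟨lam, ⟨fun x hx => ((hlam x x).1 hx).1 le_rfl, ?_⟩, ?_⟩
  · intro x y z hxy hyz
    obtain ⟨x1, x2, x3⟩ := (hlam x y).1 hxy
    obtain ⟨z1, z2, z3⟩ := (hlam y z).1 hyz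
    have z4 := hlam' y z hyz
    have c1 : ¬ x ≤ z := by
      intro hxz
      obtain ⟨F, φ, hF, hxF, hzF⟩ := hthrough x z hxz
      obtain ⟨r, r1, r2, he⟩ := cross hF (hP y) (hY.monotone hxz)
        (by rw [hF.val x hxF]; exact x3.le) (by rw [hF.val z hzF]; exact z4.le)
      rcases le_total r (f y).2 with h | h
      · exact x1 (meet hF (hP y) hxF (hS y) r1 h he)
      · exact z1 (meet (hP y) hF (hS y) hzF h r2 he.symm)
    have c2 : ¬ z ≤ x := by
      intro hzx
      obtain ⟨F, φ, hF, hzF, hxF⟩ := hthrough z x hzx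
      obtain ⟨r, r1, r2, he⟩ := cross (hP y) hF (hY.monotone hzx)
        (by rw [hF.val z hzF]; exact z4.le) (by rw [hF.val x hxF]; exact x3.le)
      rcases le_total r (f y).2 with h | h
      · exact z2 (meet hF (hP y) hzF (hS y) r1 h he.symm)
      · exact x2 (meet (hP y) hF (hS y) hxF h r2 he)
    by_contra hcon
    have hzx : lam z x := by
      rw [hlam] at hcon ⊢
      have := hasymm x z c1 c2
      tauto
    have a1 := cyc x y z hxy hyz hzx
    have a2 := cyc y z x hyz hzx hxy
    have a3 := cyc z x y hzx hxy hyz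
    rcases le_total (f x).2 (f y).2 with h1 | h1
    · rcases le_total (f y).2 (f z).2 with h2 | h2
      · exact a1 (Or.inl ⟨h1, h2⟩)
      · rcases le_total (f z).2 (f x).2 with h3 | h3
        · exact a3 (Or.inl ⟨h3, h1⟩)
        · exact a2 (Or.inr ⟨h3, h2⟩)
    · rcases le_total (f y).2 (f z).2 with h2 | h2
      · rcases le_total (f z).2 (f x).2 with h3 | h3
        · exact a2 (Or.inl ⟨h2, h3⟩)
        · exact a3 (Or.inr ⟨h1, h3⟩)
      · exact a1 (Or.inr ⟨h2, h1⟩)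
  · intro x y hxy
    have e1 : x < y ↔ x ≤ y := ⟨le_of_lt, fun h => lt_of_le_of_ne h hxy⟩
    have e2 : y < x ↔ y ≤ x := ⟨le_of_lt, fun h => lt_of_le_of_ne h hxy.symm⟩
    have := hasymm x y
    simp only [Xor', Xor, hlam, e1, e2]
    tauto

end Zilber

/-- **Zilber's Theorem.** A finite lattice `L` is planar iff it has a complementary order
relation. -/
theorem zilber_theorem {L : Type*} [Lattice L] [Finite L] :
    IsPlanarLattice L ↔
      ∃ lam : L → L → Prop,
        IsStrictOrderRel lam ∧ ComplementaryTo (· < · : L → L → Prop) lam := by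
  constructor
  · exact Zilber.forward
  · rintro ⟨lam, h1, h2⟩
    exact Zilber.backward lam h1 h2
end

section
/- A finite lattice L is planar if and only if the strict order of L is the intersection of two strict linear orders on L (i.e., L has order dimension at most 2). -/
/-- `r` is a strict linear order: irreflexive, transitive, and any two distinct elements are
comparable. -/
def IsStrictLinearOrderRel {P : Type*} (r : P → P → Prop) : Prop :=
  (∀ a, ¬ r a a) ∧ (∀ a b c, r a b → r b c → r a c) ∧ ∀ a b : P, a ≠ b → r a b ∨ r b a

namespace PlanarDim

section toPlanar

variable {L : Type*} [Lattice L]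

lemma exists_rank [Finite L] (t : L → L → Prop) (ht : IsStrictLinearOrderRel t) :
    ∃ x : L → ℝ, ∀ a b, t a b ↔ x a < x b := by
  obtain ⟨hi, htr, htot⟩ := ht
  have key : ∀ a b, t a b → ({c | t c a} : Set L).ncard < ({c | t c b} : Set L).ncard := by
    intro a b hab
    apply Set.ncard_lt_ncard _ (Set.toFinite _)
    refine ⟨fun c hc => htr _ _ _ hc hab, fun h => hi a (h hab)⟩
  refine ⟨fun a => (({c | t c a} : Set L).ncard : ℝ), fun a b => ⟨fun h => ?_, fun h => ?_⟩⟩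
  · exact Nat.cast_lt.2 (key a b h)
  · have h' : ({c | t c a} : Set L).ncard < ({c | t c b} : Set L).ncard := Nat.cast_lt.1 h
    by_contra hn
    by_cases hab : a = b
    · subst hab; omega
    · rcases htot a b hab with h1 | h1
      · exact hn h1
      · have := key b a h1; omega

lemma planar_of_ranks [Finite L] (x y : L → ℝ)
    (hx : Function.Injective x) (hle : ∀ a b, a ≤ b ↔ x a ≤ x b ∧ y a ≤ y b) :
    IsPlanarLattice L := by
  let f : L → ℝ × ℝ := fun a => (y a - x a, x a + y a)
  have seg : ∀ p q z, z ∈ segment ℝ (f p) (f q) → ∃ s : ℝ, 0 ≤ s ∧ s ≤ 1 ∧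
      z.2 - z.1 = 2 * ((1 - s) * x p + s * x q) ∧ z.1 + z.2 = 2 * ((1 - s) * y p + s * y q) := by
    rintro p q z ⟨a, b, ha, hb, hab, rfl⟩
    obtain rfl : a = 1 - b := by linarith
    refine ⟨b, hb, by linarith, ?_, ?_⟩ <;> simp [f] <;> ring
  have bnd : ∀ p q z, p ≤ q → z ∈ segment ℝ (f p) (f q) →
      (2 * x p ≤ z.2 - z.1 ∧ 2 * y p ≤ z.1 + z.2) ∧
      (z.2 - z.1 ≤ 2 * x q ∧ z.1 + z.2 ≤ 2 * y q) := by
    intro p q z hpq hz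
    obtain ⟨s, h0, h1, e1, e2⟩ := seg p q z hz
    obtain ⟨h3, h4⟩ := (hle p q).1 hpq
    rw [e1, e2]
    refine ⟨⟨?_, ?_⟩, ?_, ?_⟩ <;> nlinarith
  have fe : ∀ p z, z.2 - z.1 = 2 * x p → z.1 + z.2 = 2 * y p → z = f p := by
    intro p z h1 h2
    apply Prod.ext <;> simp only [f] <;> linarith
  have two : ∀ p z, (2 * x p ≤ z.2 - z.1 ∧ 2 * y p ≤ z.1 + z.2) →
      (z.2 - z.1 ≤ 2 * x p ∧ z.1 + z.2 ≤ 2 * y p) → z = f p := by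
    intro p z h1 h2
    exact fe p z (by linarith) (by linarith)
  have finj : Function.Injective f := by
    intro a b h
    have h1 : y a - x a = y b - x b := congrArg Prod.fst h
    have h2 : x a + y a = x b + y b := congrArg Prod.snd h
    exact hx (by linarith)
  refine ⟨f, finj, ?_, ?_, ?_⟩
  · intro p q hpq
    obtain ⟨h1, h2⟩ := (hle p q).1 hpq.le
    have h3 : x p ≠ x q := fun h => hpq.ne (hx h)
    have := lt_of_le_of_ne h1 h3
    simp only [f]; linarith
  · intro p q hpq r hr
    obtain ⟨⟨h1, h2⟩, h3, h4⟩ := bnd p q _ hpq.le hr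
    simp only [f] at h1 h2 h3 h4
    have a1 : p ≤ r := (hle _ _).2 ⟨by linarith, by linarith⟩
    have a2 : r ≤ q := (hle _ _).2 ⟨by linarith, by linarith⟩
    rcases hpq.eq_or_eq a1 a2 with h | h
    · left; rw [h]
    · right; rw [h]
  · rintro a b c d hab hcd hne z ⟨hz1, hz2⟩
    obtain ⟨B1, B2⟩ := bnd a b z hab.le hz1
    obtain ⟨B3, B4⟩ := bnd c d z hcd.le hz2
    have had : a ≤ d := (hle _ _).2 ⟨by linarith, by linarith⟩
    have hcb : c ≤ b := (hle _ _).2 ⟨by linarith, by linarith⟩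
    obtain ⟨s, s0, s1, e1, e2⟩ := seg a b z hz1
    obtain ⟨t, t0, t1, e3, e4⟩ := seg c d z hz2
    rcases hab.eq_or_eq (le_sup_left : a ≤ a ⊔ c) (sup_le hab.le hcb) with h | h
    · have hca : c ≤ a := sup_eq_left.1 h
      rcases hcd.eq_or_eq hca had with h | h
      · subst h
        have hz : z = f a := by
          by_contra hzn
          have hs : 0 < s := by
            rcases s0.eq_or_lt with h | h
            · subst h; exact absurd (fe a z (by linarith) (by linarith)) hzn
            · exact h
          have ht : 0 < t := by
            rcases t0.eq_or_lt with h | h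
            · subst h; exact absurd (fe a z (by linarith) (by linarith)) hzn
            · exact h
          have ab := (hle _ _).1 hab.le
          have ad := (hle _ _).1 hcd.le
          apply hne
          rcases le_total t s with hst | hst
          · have : b ≤ d := by
              refine (hle _ _).2 ⟨?_, ?_⟩
              · by_contra hh; push Not at hh
                nlinarith [mul_pos hs (sub_pos.2 hh), mul_nonneg (sub_nonneg.2 hst) (sub_nonneg.2 ad.1)]
              · by_contra hh; push Not at hh
                nlinarith [mul_pos hs (sub_pos.2 hh), mul_nonneg (sub_nonneg.2 hst) (sub_nonneg.2 ad.2)]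
            rcases hcd.eq_or_eq hab.le this with h | h
            · exact absurd h hab.ne'
            · rw [h]
          · have : d ≤ b := by
              refine (hle _ _).2 ⟨?_, ?_⟩
              · by_contra hh; push Not at hh
                nlinarith [mul_pos ht (sub_pos.2 hh), mul_nonneg (sub_nonneg.2 hst) (sub_nonneg.2 ab.1)]
              · by_contra hh; push Not at hh
                nlinarith [mul_pos ht (sub_pos.2 hh), mul_nonneg (sub_nonneg.2 hst) (sub_nonneg.2 ab.2)]
            rcases hab.eq_or_eq hcd.le this with h | h
            · exact absurd h hcd.ne'
            · rw [h]
        simp [hz]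
      · subst h
        have hz : z = f a := two a z B1 B4
        simp [hz]
    · have hbd : b ≤ d := h ▸ sup_le had hcd.le
      rcases hcd.eq_or_eq hcb hbd with h | h
      · subst h
        have hz : z = f b := two b z B3 B2
        simp [hz]
      · subst h
        have hz : z = f b := by
          by_contra hzn
          have hs : 0 < 1 - s := by
            rcases s1.eq_or_lt with h | h
            · subst h; exact absurd (fe b z (by linarith) (by linarith)) hzn
            · linarith
          have ht : 0 < 1 - t := by
            rcases t1.eq_or_lt with h | h
            · subst h; exact absurd (fe b z (by linarith) (by linarith)) hzn
            · linarith
          have ab := (hle _ _).1 hab.le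
          have cb := (hle _ _).1 hcd.le
          apply hne
          rcases le_total s t with hst | hst
          · have : c ≤ a := by
              refine (hle _ _).2 ⟨?_, ?_⟩
              · by_contra hh; push Not at hh
                nlinarith [mul_pos hs (sub_pos.2 hh), mul_nonneg (sub_nonneg.2 hst) (sub_nonneg.2 cb.1)]
              · by_contra hh; push Not at hh
                nlinarith [mul_pos hs (sub_pos.2 hh), mul_nonneg (sub_nonneg.2 hst) (sub_nonneg.2 cb.2)]
            rcases hcd.eq_or_eq this hab.le with h | h
            · rw [h]
            · exact absurd h hab.ne
          · have : a ≤ c := by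
              refine (hle _ _).2 ⟨?_, ?_⟩
              · by_contra hh; push Not at hh
                nlinarith [mul_pos ht (sub_pos.2 hh), mul_nonneg (sub_nonneg.2 hst) (sub_nonneg.2 ab.1)]
              · by_contra hh; push Not at hh
                nlinarith [mul_pos ht (sub_pos.2 hh), mul_nonneg (sub_nonneg.2 hst) (sub_nonneg.2 ab.2)]
            rcases hab.eq_or_eq this hcd.le with h | h
            · rw [h]
            · exact absurd h hcd.ne
        simp [hz]

end toPlanar

section ofPlanar

variable {L : Type*} [PartialOrder L]

/-- `z` lies on the diagram of the interval `[a, b]`. -/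
def OnInt (f : L → ℝ × ℝ) (a b : L) (z : ℝ × ℝ) : Prop :=
  ∃ p q, a ≤ p ∧ q ≤ b ∧ p ⩿ q ∧ z ∈ segment ℝ (f p) (f q)

/-- `g` is a curve (a graph over the `y`-axis) from `a` to `b` inside the diagram of `[a, b]`. -/
structure IsCurve (f : L → ℝ × ℝ) (a b : L) (g : ℝ → ℝ) : Prop where
  cont : Continuous g
  bot : g (f a).2 = (f a).1
  top : g (f b).2 = (f b).1
  on : ∀ y, (f a).2 ≤ y → y ≤ (f b).2 → OnInt f a b (g y, y)

lemma exists_curve [Finite L] (f : L → ℝ × ℝ) (hy : ∀ p q : L, p ⋖ q → (f p).2 < (f q).2)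
    (a b : L) (hab : a ≤ b) : (f a).2 ≤ (f b).2 ∧ ∃ g, IsCurve f a b g := by
  classical
  have := Fintype.ofFinite L
  let : LocallyFiniteOrder L := Fintype.toLocallyFiniteOrder
  have h := le_iff_reflTransGen_covBy.1 hab
  clear hab
  induction h with
  | refl =>
    refine ⟨le_rfl, fun _ => (f a).1, continuous_const, rfl, rfl, fun y h1 h2 => ?_⟩
    refine ⟨a, a, le_rfl, le_rfl, WCovBy.rfl, ?_⟩
    obtain rfl : y = (f a).2 := le_antisymm h2 h1
    simp
  | @tail b c hb hbc ih =>
    obtain ⟨hle, g, hg⟩ := ih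
    have hab : a ≤ b := le_iff_reflTransGen_covBy.2 hb
    have hlt := hy b c hbc
    have hpos : 0 < (f c).2 - (f b).2 := by linarith
    let k : ℝ → ℝ := fun y =>
      (f b).1 + (y - (f b).2) / ((f c).2 - (f b).2) * ((f c).1 - (f b).1)
    refine ⟨by linarith, fun y => if y ≤ (f b).2 then g y else k y, ?_, ?_, ?_, ?_⟩
    · refine Continuous.if_le hg.cont (by fun_prop) continuous_id continuous_const ?_
      rintro y rfl
      simp [k, hg.top]
    · simp [hle, hg.bot]
    · have : ¬ (f c).2 ≤ (f b).2 := by linarith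
      simp only [this, if_false, k]
      rw [div_self hpos.ne']; ring
    · intro y h1 h2
      by_cases h : y ≤ (f b).2
      · simp only [h, if_true]
        obtain ⟨p, q, hp, hq, hpq, hz⟩ := hg.on y h1 h
        exact ⟨p, q, hp, hq.trans hbc.le, hpq, hz⟩
      · simp only [h, if_false]
        push Not at h
        refine ⟨b, c, hab, le_rfl, hbc.wcovBy, ?_⟩
        set t := (y - (f b).2) / ((f c).2 - (f b).2) with ht
        have hyt : t * ((f c).2 - (f b).2) = y - (f b).2 := by
          rw [ht]; field_simp
        refine ⟨1 - t, t, ?_, ?_, by ring, ?_⟩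
        · rw [ht, sub_nonneg, div_le_one hpos]; linarith
        · exact div_nonneg (by linarith) hpos.le
        · apply Prod.ext
          · simp [k, ← ht]; ring
          · simp; linarith

/-- Bundled geometric facts on a planar diagram. -/
structure Planar (f : L → ℝ × ℝ) : Prop where
  inj : Function.Injective f
  up : ∀ p q : L, p ⋖ q → (f p).2 < (f q).2
  nonint : ∀ p q : L, p ⋖ q → ∀ r : L, f r ∈ segment ℝ (f p) (f q) → f r = f p ∨ f r = f q
  planar : ∀ p q p' q' : L, p ⋖ q → p' ⋖ q' → (p, q) ≠ (p', q') →
      segment ℝ (f p) (f q) ∩ segment ℝ (f p') (f q') ⊆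
        ({f p, f q} ∩ {f p', f q'} : Set (ℝ × ℝ))

lemma Planar.cross {f : L → ℝ × ℝ} (hf : Planar f) {a b c d : L} {z : ℝ × ℝ}
    (h1 : OnInt f a b z) (h2 : OnInt f c d z) : a ≤ d ∧ c ≤ b := by
  obtain ⟨p, q, hp, hq, hpq, hz⟩ := h1
  obtain ⟨r, s, hr, hs, hrs, hw⟩ := h2
  suffices H : ∃ v, (v = p ∨ v = q) ∧ (v = r ∨ v = s) by
    obtain ⟨v, h1, h2⟩ := H
    have a1 : p ≤ v := by rcases h1 with rfl | rfl; exacts [le_rfl, hpq.le]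
    have a2 : v ≤ q := by rcases h1 with rfl | rfl; exacts [hpq.le, le_rfl]
    have a3 : r ≤ v := by rcases h2 with rfl | rfl; exacts [le_rfl, hrs.le]
    have a4 : v ≤ s := by rcases h2 with rfl | rfl; exacts [hrs.le, le_rfl]
    exact ⟨hp.trans (a1.trans (a4.trans hs)), hr.trans (a3.trans (a2.trans hq))⟩
  rcases wcovBy_iff_covBy_or_eq.1 hpq with h | rfl
  · rcases wcovBy_iff_covBy_or_eq.1 hrs with h' | rfl
    · by_cases he : (p, q) = (r, s)
      · obtain ⟨rfl, rfl⟩ := Prod.mk.inj he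
        exact ⟨p, Or.inl rfl, Or.inl rfl⟩
      · obtain ⟨m1, m2⟩ := hf.planar p q r s h h' he ⟨hz, hw⟩
        rcases m1 with m1 | m1
        · refine ⟨p, Or.inl rfl, ?_⟩
          rcases m2 with m2 | m2
          · exact Or.inl (hf.inj (m1.symm.trans m2))
          · exact Or.inr (hf.inj (m1.symm.trans m2))
        · refine ⟨q, Or.inr rfl, ?_⟩
          rcases m2 with m2 | m2
          · exact Or.inl (hf.inj (m1.symm.trans m2))
          · exact Or.inr (hf.inj (m1.symm.trans m2))
    · rw [segment_same, Set.mem_singleton_iff] at hw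
      subst hw
      exact ⟨r, (hf.nonint p q h r hz).imp (fun h => hf.inj h) (fun h => hf.inj h), Or.inl rfl⟩
  · rw [segment_same, Set.mem_singleton_iff] at hz
    subst hz
    rcases wcovBy_iff_covBy_or_eq.1 hrs with h' | rfl
    · exact ⟨p, Or.inl rfl,
        (hf.nonint r s h' p hw).imp (fun h => hf.inj h) (fun h => hf.inj h)⟩
    · rw [segment_same, Set.mem_singleton_iff] at hw
      exact ⟨p, Or.inl rfl, Or.inl (hf.inj hw)⟩

lemma sign_aux {g h : ℝ → ℝ} (hg : Continuous g) (hh : Continuous h) {s t : ℝ}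
    (hne : ∀ y ∈ Set.uIcc s t, g y ≠ h y) (hs : g s < h s) : g t < h t := by
  by_contra hn
  push Not at hn
  have := intermediate_value_uIcc (a := s) (b := t) (f := fun y => g y - h y)
    (by fun_prop : Continuous fun y => g y - h y).continuousOn
  have h0 : (0 : ℝ) ∈ Set.uIcc (g s - h s) (g t - h t) := by
    rw [Set.mem_uIcc]; left; constructor <;> linarith
  obtain ⟨y, hy, he⟩ := this h0
  exact hne y hy (sub_eq_zero.1 he)

lemma Planar.sign {f : L → ℝ × ℝ} (hf : Planar f) {a b c d : L} {g h : ℝ → ℝ}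
    (hg : IsCurve f a b g) (hh : IsCurve f c d h) (hn : ¬ (a ≤ d ∧ c ≤ b)) {s t : ℝ}
    (s1 : (f a).2 ≤ s) (s2 : (f c).2 ≤ s) (s3 : s ≤ (f b).2) (s4 : s ≤ (f d).2)
    (t1 : (f a).2 ≤ t) (t2 : (f c).2 ≤ t) (t3 : t ≤ (f b).2) (t4 : t ≤ (f d).2) :
    g s < h s ↔ g t < h t := by
  have hne : ∀ y ∈ Set.uIcc s t, g y ≠ h y := by
    intro y hy he
    have l : ∀ e, e ≤ s → e ≤ t → e ≤ y := fun e h1 h2 => (le_inf h1 h2).trans hy.1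
    have u : ∀ e, s ≤ e → t ≤ e → y ≤ e := fun e h1 h2 => hy.2.trans (sup_le h1 h2)
    have o1 := hg.on y (l _ s1 t1) (u _ s3 t3)
    have o2 := hh.on y (l _ s2 t2) (u _ s4 t4)
    rw [he] at o1
    exact hn (hf.cross o1 o2)
  exact ⟨sign_aux hg.cont hh.cont hne, sign_aux hg.cont hh.cont (by rwa [Set.uIcc_comm])⟩

lemma exists_left [Finite L] [BoundedOrder L] {f : L → ℝ × ℝ} (hf : Planar f) :
    ∃ lam : L → L → Prop,
      (∀ a b, lam a b → ¬ a ≤ b ∧ ¬ b ≤ a) ∧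
      (∀ a b, ¬ a ≤ b → ¬ b ≤ a → lam a b ∨ lam b a) ∧
      (∀ a b, lam a b → ¬ lam b a) ∧
      (∀ a b c, a ≤ b → ¬ a ≤ c → ¬ c ≤ b → (lam c a ↔ lam c b)) ∧
      (∀ a b c, lam a b → lam b c → ¬ lam c a) := by
  have mono : ∀ a b : L, a ≤ b → (f a).2 ≤ (f b).2 := fun a b h => (exists_curve f hf.up a b h).1
  have cur : ∀ a b : L, a ≤ b → ∃ g, IsCurve f a b g := fun a b h => (exists_curve f hf.up a b h).2
  choose U hU using fun a : L => cur a ⊤ le_top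
  choose D hD using fun a : L => cur ⊥ a bot_le
  have yT : ∀ a : L, (f a).2 ≤ (f ⊤).2 := fun a => mono _ _ le_top
  have yB : ∀ a : L, (f ⊥).2 ≤ (f a).2 := fun a => mono _ _ bot_le
  let lam : L → L → Prop := fun a b => (¬ a ≤ b ∧ ¬ b ≤ a) ∧
    U a (max (f a).2 (f b).2) < U b (max (f a).2 (f b).2)
  have DU : ∀ a, D a (f a).2 = U a (f a).2 := fun a => (hD a).top.trans (hU a).bot.symm
  -- separation between an up-curve and a down-curve
  have sepUD : ∀ a c, ¬ a ≤ c → ∀ s t, (f a).2 ≤ s → s ≤ (f c).2 → (f a).2 ≤ t → t ≤ (f c).2 →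
      (U a s < D c s ↔ U a t < D c t) := fun a c h s t s1 s2 t1 t2 =>
    hf.sign (hU a) (hD c) (fun h' => h h'.1) s1 ((yB a).trans s1) (s2.trans (yT c)) s2
      t1 ((yB a).trans t1) (t2.trans (yT c)) t2
  have sepDU : ∀ a c, ¬ a ≤ c → ∀ s t, (f a).2 ≤ s → s ≤ (f c).2 → (f a).2 ≤ t → t ≤ (f c).2 →
      (D c s < U a s ↔ D c t < U a t) := fun a c h s t s1 s2 t1 t2 =>
    hf.sign (hD c) (hU a) (fun h' => h h'.2) ((yB a).trans s1) s1 s2 (s2.trans (yT c))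
      ((yB a).trans t1) t1 t2 (t2.trans (yT c))
  -- reading `lam` at any level
  have lamUD : ∀ a c, ¬ a ≤ c → ¬ c ≤ a → ∀ s, (f a).2 ≤ s → s ≤ (f c).2 →
      (lam a c ↔ U a s < D c s) := by
    intro a c h1 h2 s s1 s2
    have h3 := s1.trans s2
    rw [sepUD a c h1 s (f c).2 s1 s2 h3 le_rfl, DU]
    simp [lam, h1, h2, max_eq_right h3]
  have lamDU : ∀ a c, ¬ a ≤ c → ¬ c ≤ a → ∀ s, (f a).2 ≤ s → s ≤ (f c).2 →
      (lam c a ↔ D c s < U a s) := by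
    intro a c h1 h2 s s1 s2
    have h3 := s1.trans s2
    rw [sepDU a c h1 s (f c).2 s1 s2 h3 le_rfl, DU]
    simp [lam, h1, h2, max_eq_left h3]
  have cyc : ∀ a b c, (f a).2 ≤ (f c).2 → (f b).2 ≤ (f c).2 →
      lam a b → lam b c → ¬ lam c a := by
    intro a b c h1 h2 ab bc ca
    have hY := max_le h1 h2
    have i1 := (lamUD b c bc.1.1 bc.1.2 _ (le_max_right (f a).2 (f b).2) hY).1 bc
    have i2 := (lamDU a c ca.1.2 ca.1.1 _ (le_max_left (f a).2 (f b).2) hY).1 ca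
    exact absurd (ab.2.trans (i1.trans i2)) (lt_irrefl _)
  refine ⟨lam, fun a b h => h.1, ?_, ?_, ?_, ?_⟩
  · intro a b h1 h2
    rcases lt_trichotomy (U a (max (f a).2 (f b).2)) (U b (max (f a).2 (f b).2)) with h | h | h
    · exact Or.inl ⟨⟨h1, h2⟩, h⟩
    · exfalso
      have o1 := (hU a).on _ (le_max_left (f a).2 (f b).2) (max_le (yT a) (yT b))
      have o2 := (hU b).on _ (le_max_right (f a).2 (f b).2) (max_le (yT a) (yT b))
      rcases le_total (f a).2 (f b).2 with hl | hl
      · rw [h, max_eq_right hl, (hU b).bot] at o1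
        have : OnInt f b b ((f b).1, (f b).2) := ⟨b, b, le_rfl, le_rfl, WCovBy.rfl, by simp⟩
        exact h1 (hf.cross o1 this).1
      · rw [← h, max_eq_left hl, (hU a).bot] at o2
        have : OnInt f a a ((f a).1, (f a).2) := ⟨a, a, le_rfl, le_rfl, WCovBy.rfl, by simp⟩
        exact h2 (hf.cross o2 this).1
    · exact Or.inr ⟨⟨h2, h1⟩, by rwa [max_comm]⟩
  · intro a b h1 h2
    have := h2.2
    rw [max_comm] at this
    exact lt_asymm h1.2 this
  · intro a b c hab hac hcb
    have hca : ¬ c ≤ a := fun h => hcb (h.trans hab)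
    have hbc : ¬ b ≤ c := fun h => hac (hab.trans h)
    obtain ⟨M, hM⟩ := cur a b hab
    have yab := mono a b hab
    have Ma : M (f a).2 = U a (f a).2 := hM.bot.trans (hU a).bot.symm
    have Mb : M (f b).2 = U b (f b).2 := hM.top.trans (hU b).bot.symm
    have Mb' : M (f b).2 = D b (f b).2 := hM.top.trans (hD b).top.symm
    have Ma' : M (f a).2 = D a (f a).2 := hM.bot.trans (hD a).top.symm
    rcases le_total (f b).2 (f c).2 with h1 | h1
    · rw [lamDU a c hac hca (f a).2 le_rfl (yab.trans h1), lamDU b c hbc hcb (f b).2 le_rfl h1,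
        ← Ma, ← Mb]
      exact hf.sign (hD c) hM (fun h => hac h.2) (yB a) le_rfl (yab.trans h1) yab
        (yB b) yab h1 le_rfl
    · rw [lamUD c b hcb hbc (f b).2 h1 le_rfl, ← Mb']
      rcases le_total (f a).2 (f c).2 with h2 | h2
      · rw [lamDU a c hac hca (f a).2 le_rfl h2, ← Ma,
          hf.sign (hD c) hM (fun h => hac h.2) (yB a) le_rfl h2 yab (yB c) h2 le_rfl h1, DU]
        exact hf.sign (hU c) hM (fun h => hcb h.1) le_rfl h2 (yT c) h1 h1 yab (yT b) le_rfl
      · rw [lamUD c a hca hac (f a).2 h2 le_rfl, ← Ma']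
        exact hf.sign (hU c) hM (fun h => hcb h.1) h2 le_rfl (yT a) yab h1 yab (yT b) le_rfl
  · intro a b c ab bc ca
    rcases le_total (f a).2 (f b).2 with h1 | h1
    · rcases le_total (f b).2 (f c).2 with h2 | h2
      · exact cyc a b c (h1.trans h2) h2 ab bc ca
      · exact cyc c a b h2 h1 ca ab bc
    · rcases le_total (f a).2 (f c).2 with h2 | h2
      · exact cyc a b c h2 (h1.trans h2) ab bc ca
      · exact cyc b c a h1 h2 bc ca ab

/-- An orientation of incomparable pairs without short cycles gives a linear extension. -/
lemma linear_of_left (lam : L → L → Prop)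
    (h1 : ∀ a b, lam a b → ¬ a ≤ b ∧ ¬ b ≤ a)
    (h2 : ∀ a b, ¬ a ≤ b → ¬ b ≤ a → lam a b ∨ lam b a)
    (h4 : ∀ a b c, a ≤ b → lam b c → ¬ lam c a)
    (h5 : ∀ a b c, lam a b → lam b c → ¬ lam c a) :
    IsStrictLinearOrderRel (fun a b => a < b ∨ lam a b) := by
  have tot : ∀ a b, a ≤ b ∨ b < a ∨ lam a b ∨ lam b a := by
    intro a b
    by_cases ha : a ≤ b
    · exact Or.inl ha
    by_cases hb : b ≤ a
    · exact Or.inr (Or.inl (lt_of_le_not_ge hb ha))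
    · exact Or.inr (Or.inr (h2 a b ha hb))
  refine ⟨?_, ?_, ?_⟩
  · rintro a (h | h)
    · exact lt_irrefl _ h
    · exact (h1 a a h).1 le_rfl
  · have fin : ∀ a c, ¬ c ≤ a → ¬ lam c a → a < c ∨ lam a c := by
      intro a c n1 n2
      rcases tot c a with h | h | h | h
      · exact absurd h n1
      · exact Or.inl h
      · exact absurd h n2
      · exact Or.inr h
    rintro a b c (ab | ab) (bc | bc)
    · exact Or.inl (ab.trans bc)
    · exact fin a c (fun h => (h1 _ _ bc).2 (h.trans ab.le)) (h4 a b c ab.le bc)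
    · exact fin a c (fun h => (h1 _ _ ab).2 (bc.le.trans h)) (fun h => h4 b c a bc.le h ab)
    · exact fin a c (fun h => h4 c a b h ab bc) (h5 a b c ab bc)
  · intro a b hab
    rcases tot a b with h | h | h | h
    · exact Or.inl (Or.inl (lt_of_le_of_ne h hab))
    · exact Or.inr (Or.inl h)
    · exact Or.inl (Or.inr h)
    · exact Or.inr (Or.inr h)

end ofPlanar

end PlanarDim

/-- A finite lattice `L` is planar iff its strict order is the intersection of two strict
linear orders on `L` (i.e., `L` has order dimension at most `2`). -/
theorem planar_iff_dimension_le_two {L : Type*} [Lattice L] [Finite L] :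
    IsPlanarLattice L ↔
      ∃ t₁ t₂ : L → L → Prop, IsStrictLinearOrderRel t₁ ∧ IsStrictLinearOrderRel t₂ ∧
        ∀ a b : L, a < b ↔ t₁ a b ∧ t₂ a b := by
  constructor
  · rintro ⟨f, hinj, hup, hni, hpl⟩
    rcases isEmpty_or_nonempty L with hL | hL
    · refine ⟨fun _ _ => False, fun _ _ => False, ?_, ?_, fun a => (hL.false a).elim⟩ <;>
      exact ⟨fun a => (hL.false a).elim, fun a => (hL.false a).elim, fun a => (hL.false a).elim⟩
    · have := Fintype.ofFinite L
      let : BoundedOrder L := Fintype.toBoundedOrder L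
      obtain ⟨lam, h1, h2, h3, h4, h5⟩ :=
        PlanarDim.exists_left (f := f) ⟨hinj, hup, hni, hpl⟩
      refine ⟨fun a b => a < b ∨ lam a b, fun a b => a < b ∨ lam b a, ?_, ?_, ?_⟩
      · refine PlanarDim.linear_of_left lam h1 h2 ?_ h5
        intro a b c hab bc ca
        exact h3 _ _ bc ((h4 a b c hab (h1 _ _ ca).2 (h1 _ _ bc).2).1 ca)
      · refine PlanarDim.linear_of_left (fun a b => lam b a) (fun a b h => (h1 _ _ h).symm)
          (fun a b n1 n2 => (h2 a b n1 n2).symm) ?_ ?_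
        · intro a b c hab cb ac
          exact h3 _ _ ac ((h4 a b c hab (h1 _ _ ac).1 (h1 _ _ cb).1).2 cb)
        · intro a b c ba cb ac
          exact h5 _ _ _ ac cb ba
      · intro a b
        constructor
        · intro h; exact ⟨Or.inl h, Or.inl h⟩
        · rintro ⟨h | h, h' | h'⟩
          · exact h
          · exact h
          · exact h'
          · exact absurd h' (h3 _ _ h)
  · rintro ⟨t₁, t₂, ht₁, ht₂, hlt⟩
    obtain ⟨x, hx⟩ := PlanarDim.exists_rank t₁ ht₁
    obtain ⟨y, hy⟩ := PlanarDim.exists_rank t₂ ht₂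
    have hxi : Function.Injective x := by
      intro a b h
      by_contra hn
      rcases ht₁.2.2 a b hn with h' | h'
      · exact absurd ((hx _ _).1 h') (by rw [h]; exact lt_irrefl _)
      · exact absurd ((hx _ _).1 h') (by rw [h]; exact lt_irrefl _)
    have hyi : Function.Injective y := by
      intro a b h
      by_contra hn
      rcases ht₂.2.2 a b hn with h' | h'
      · exact absurd ((hy _ _).1 h') (by rw [h]; exact lt_irrefl _)
      · exact absurd ((hy _ _).1 h') (by rw [h]; exact lt_irrefl _)
    refine PlanarDim.planar_of_ranks x y hxi ?_
    intro a b
    by_cases hab : a = b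
    · subst hab; simp
    · rw [← lt_iff_le_and_ne.trans (and_iff_left hab), hlt, hx, hy]
      have n1 : x a ≠ x b := fun h => hab (hxi h)
      have n2 : y a ≠ y b := fun h => hab (hyi h)
      rw [n1.le_iff_lt, n2.le_iff_lt]
end

section
/- A finite lattice L is planar if and only if there exist two finite linearly ordered sets (chains) C₁ and C₂ and an order embedding of L into the product C₁ × C₂ with the componentwise (product) order, i.e., a map f : L → C₁ × C₂ with p ≤ q in L iff f p ≤ f q in C₁ × C₂. -/
structure PlDiag {L : Type*} [Lattice L] (f : L → ℝ × ℝ) : Prop where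
  inj : Function.Injective f
  iso : ∀ p q : L, p ⋖ q → (f p).2 < (f q).2
  nonint : ∀ p q : L, p ⋖ q → ∀ r : L, f r ∈ segment ℝ (f p) (f q) → f r = f p ∨ f r = f q
  plan : ∀ p q p' q' : L, p ⋖ q → p' ⋖ q' → (p, q) ≠ (p', q') →
      segment ℝ (f p) (f q) ∩ segment ℝ (f p') (f q') ⊆
        ({f p, f q} ∩ {f p', f q'} : Set (ℝ × ℝ))

/-! ### Segments in the plane -/

theorem seg_snd_mem {P Q z : ℝ × ℝ} (h : z ∈ segment ℝ P Q) (hPQ : P.2 ≤ Q.2) :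
    P.2 ≤ z.2 ∧ z.2 ≤ Q.2 := by
  obtain ⟨a, b, ha, hb, hab, rfl⟩ := h
  have : a = 1 - b := by linarith
  subst this
  simp only [Prod.snd_add, Prod.smul_snd, smul_eq_mul]
  constructor <;> nlinarith

theorem seg_uniq {P Q z w : ℝ × ℝ} (hz : z ∈ segment ℝ P Q) (hw : w ∈ segment ℝ P Q)
    (hPQ : P.2 < Q.2) (h : z.2 = w.2) : z = w := by
  obtain ⟨a, b, ha, hb, hab, rfl⟩ := hz
  obtain ⟨a', b', ha', hb', hab', rfl⟩ := hw
  have h1 : a = 1 - b := by linarith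
  have h2 : a' = 1 - b' := by linarith
  subst h1 h2
  simp only [Prod.snd_add, Prod.smul_snd, smul_eq_mul] at h
  have h3 : (b - b') * (Q.2 - P.2) = 0 := by linarith
  have h4 : b = b' := by
    rcases mul_eq_zero.1 h3 with h | h <;> linarith
  rw [h4]

theorem seg_exists {P Q : ℝ × ℝ} {t : ℝ} (h1 : P.2 ≤ t) (h2 : t ≤ Q.2) :
    ∃ x, (x, t) ∈ segment ℝ P Q := by
  have ht : t ∈ segment ℝ P.2 Q.2 := by
    rw [segment_eq_Icc (h1.trans h2)]; exact ⟨h1, h2⟩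
  obtain ⟨a, b, ha, hb, hab, rfl⟩ := ht
  exact ⟨a • P.1 + b • Q.1, a, b, ha, hb, hab, by ext <;> simp⟩

section
variable {L : Type*} [Lattice L] [Finite L] {f : L → ℝ × ℝ}

theorem PlDiag.mono (hf : PlDiag f) : StrictMono fun a => (f a).2 := by
  classical
  haveI := Fintype.ofFinite L
  letI : LocallyFiniteOrder L := Fintype.toLocallyFiniteOrder
  intro a b hab
  rw [lt_iff_transGen_covBy] at hab
  induction hab with
  | single h => exact hf.iso _ _ h
  | tail _ h ih => exact lt_trans ih (hf.iso _ _ h)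

/-- The curve of a maximal chain. -/
def gr (f : L → ℝ × ℝ) (C : Flag L) : Set (ℝ × ℝ) :=
  {z | ∃ p ∈ C, ∃ q ∈ C, p ⩿ q ∧ z ∈ segment ℝ (f p) (f q)}

theorem mem_gr {C : Flag L} {a : L} (h : a ∈ C) : f a ∈ gr f C :=
  ⟨a, h, a, h, WCovBy.rfl, left_mem_segment ..⟩

theorem PlDiag.end_left (hf : PlDiag f) {p q : L} (h : p ≤ q) {z : ℝ × ℝ}
    (hz : z ∈ segment ℝ (f p) (f q)) (hy : z.2 = (f p).2) : z = f p := by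
  rcases h.eq_or_lt with rfl | h
  · simpa using hz
  · exact seg_uniq hz (left_mem_segment ..) (hf.mono h) hy

theorem PlDiag.end_right (hf : PlDiag f) {p q : L} (h : p ≤ q) {z : ℝ × ℝ}
    (hz : z ∈ segment ℝ (f p) (f q)) (hy : z.2 = (f q).2) : z = f q := by
  rcases h.eq_or_lt with rfl | h
  · simpa using hz
  · exact seg_uniq hz (right_mem_segment ..) (hf.mono h) hy

theorem chain_le {hf : PlDiag f} {C : Flag L} {a b : L} (ha : a ∈ C) (hb : b ∈ C)
    (h : (f a).2 ≤ (f b).2) : a ≤ b := by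
  rcases C.le_or_le ha hb with h' | h'
  · exact h'
  · rcases h'.eq_or_lt with rfl | h'
    · exact le_rfl
    · exact absurd (hf.mono h') (not_lt.2 h)

theorem gr_aux (hf : PlDiag f) {C : Flag L} {p q p' q' : L}
    (hq : q ∈ C) (hp' : p' ∈ C) {z w : ℝ × ℝ}
    (hpq : p ≤ q) (hpq' : p' ≤ q') (hz : z ∈ segment ℝ (f p) (f q))
    (hw : w ∈ segment ℝ (f p') (f q')) (h : z.2 = w.2) (hle : q ≤ p') : z = w := by
  have h1 := seg_snd_mem hz (hf.mono.monotone hpq)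
  have h2 := seg_snd_mem hw (hf.mono.monotone hpq')
  have h3 : (f q).2 ≤ (f p').2 := hf.mono.monotone hle
  have h4 : p' ≤ q := chain_le (hf := hf) hp' hq (by linarith)
  obtain rfl : q = p' := le_antisymm hle h4
  rw [hf.end_right hpq hz (by linarith), hf.end_left hpq' hw (by linarith)]

theorem gr_uniq (hf : PlDiag f) {C : Flag L} {z w : ℝ × ℝ} (hz : z ∈ gr f C) (hw : w ∈ gr f C)
    (h : z.2 = w.2) : z = w := by
  obtain ⟨p, hp, q, hq, hpq, hz⟩ := hz
  obtain ⟨p', hp', q', hq', hpq', hw⟩ := hw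
  rcases C.le_or_le hq hp' with h1 | h1
  · exact gr_aux hf hq hp' hpq.le hpq'.le hz hw h h1
  rcases C.le_or_le hq' hp with h2 | h2
  · exact (gr_aux hf hq' hp hpq'.le hpq.le hw hz h.symm h2).symm
  have e1 : ∀ r ∈ C, p ≤ r → r ≤ q → r = p ∨ r = q := fun r _ h h' => by
    exact hpq.eq_or_eq h h'
  have e2 : ∀ r ∈ C, p' ≤ r → r ≤ q' → r = p' ∨ r = q' := fun r _ h h' => by
    exact hpq'.eq_or_eq h h'
  have key : (q ≤ p' ∨ q' ≤ p) ∨ (p = p' ∧ q = q') := by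
    rcases C.le_or_le hp hp' with h3 | h3 <;> rcases C.le_or_le hq hq' with h4 | h4
    · rcases e1 p' hp' h3 h1 with rfl | rfl
      · rcases e2 q hq h1 h4 with rfl | rfl <;> simp
      · simp
    · rcases e1 p' hp' h3 h1 with rfl | rfl
      · rcases e1 q' hq' h2 h4 with rfl | rfl <;> simp
      · simp
    · rcases e2 p hp h3 h2 with rfl | rfl
      · rcases e2 q hq h1 h4 with rfl | rfl <;> simp
      · simp
    · rcases e2 p hp h3 h2 with rfl | rfl
      · rcases e1 q' hq' h2 h4 with rfl | rfl <;> simp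
      · simp
  rcases key with (h1 | h2) | ⟨rfl, rfl⟩
  · exact gr_aux hf hq hp' hpq.le hpq'.le hz hw h h1
  · exact (gr_aux hf hq' hp hpq'.le hpq.le hw hz h.symm h2).symm
  · rcases hpq.le.eq_or_lt with rfl | hlt
    · simp at hz hw; rw [hz, hw]
    · exact seg_uniq hz hw (hf.mono hlt) h

theorem gr_exists (hf : PlDiag f) (C : Flag L) {t : ℝ} (h1 : ∃ a ∈ C, (f a).2 ≤ t)
    (h2 : ∃ a ∈ C, t ≤ (f a).2) : ∃ x, (x, t) ∈ gr f C := by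
  obtain ⟨p, ⟨hp, hpt⟩, hpm⟩ := Set.exists_max_image {a | a ∈ C ∧ (f a).2 ≤ t} (fun a => (f a).2)
    (Set.toFinite _) h1
  obtain ⟨q, ⟨hq, hqt⟩, hqm⟩ := Set.exists_min_image {a | a ∈ C ∧ t ≤ (f a).2} (fun a => (f a).2)
    (Set.toFinite _) h2
  obtain ⟨x, hx⟩ := seg_exists hpt hqt
  refine ⟨x, p, hp, q, hq, ⟨chain_le (hf := hf) hp hq (hpt.trans hqt), ?_⟩, hx⟩
  intro r hpr hrq
  have hr : r ∈ C := by
    rw [Flag.mem_iff_forall_le_or_ge]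
    intro c hc
    rcases le_total (f c).2 t with h | h
    · right; exact (chain_le (hf := hf) hc hp (hpm c ⟨hc, h⟩)).trans hpr.le
    · left; exact hrq.le.trans (chain_le (hf := hf) hq hc (hqm c ⟨hc, h⟩))
  rcases le_total (f r).2 t with h | h
  · exact absurd (hpm r ⟨hr, h⟩) (not_le.2 (hf.mono hpr))
  · exact absurd (hqm r ⟨hr, h⟩) (not_le.2 (hf.mono hrq))

theorem exists_bot_mem (a : L) : ∃ m : L, m ≤ a ∧ ∀ C : Flag L, m ∈ C := by
  haveI : Nonempty L := ⟨a⟩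
  obtain ⟨m, hm⟩ := (Set.finite_univ (α := L)).bddBelow
  refine ⟨m, hm trivial, fun C => ?_⟩
  rw [Flag.mem_iff_forall_le_or_ge]
  exact fun c _ => Or.inl (hm trivial)

theorem exists_top_mem (a : L) : ∃ m : L, a ≤ m ∧ ∀ C : Flag L, m ∈ C := by
  haveI : Nonempty L := ⟨a⟩
  obtain ⟨m, hm⟩ := (Set.finite_univ (α := L)).bddAbove
  refine ⟨m, hm trivial, fun C => ?_⟩
  rw [Flag.mem_iff_forall_le_or_ge]
  exact fun c _ => Or.inr (hm trivial)

theorem gr_at (hf : PlDiag f) (C : Flag L) (a : L) : ∃ x, (x, (f a).2) ∈ gr f C := by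
  obtain ⟨m, hm, hmC⟩ := exists_bot_mem a
  obtain ⟨n, hn, hnC⟩ := exists_top_mem a
  exact gr_exists hf C ⟨m, hmC C, hf.mono.monotone hm⟩ ⟨n, hnC C, hf.mono.monotone hn⟩

theorem gr_compact (C : Flag L) : IsCompact (gr f C) := by
  have : gr f C = ⋃ i ∈ {i : L × L | i.1 ∈ C ∧ i.2 ∈ C ∧ i.1 ⩿ i.2},
      segment ℝ (f i.1) (f i.2) := by
    ext z
    simp only [gr, Set.mem_ofPred_eq, Set.mem_iUnion, Prod.exists, exists_prop]
    constructor
    · rintro ⟨p, hp, q, hq, h, hz⟩; exact ⟨p, q, ⟨hp, hq, h⟩, hz⟩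
    · rintro ⟨p, q, ⟨hp, hq, h⟩, hz⟩; exact ⟨p, hp, q, hq, h, hz⟩
  rw [this]
  refine (Set.toFinite _).isCompact_biUnion fun i _ => ?_
  rw [segment_eq_image]
  exact isCompact_Icc.image (by fun_prop)

theorem le_closed (C D : Flag L) :
    IsClosed {u : ℝ | ∃ x x', (x, u) ∈ gr f C ∧ (x', u) ∈ gr f D ∧ x ≤ x'} := by
  have hK : IsCompact ((gr f C ×ˢ gr f D) ∩
      {w : (ℝ × ℝ) × (ℝ × ℝ) | w.1.2 = w.2.2 ∧ w.1.1 ≤ w.2.1}) := by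
    refine ((gr_compact C).prod (gr_compact D)).inter_right ?_
    have c1 : IsClosed {w : (ℝ × ℝ) × (ℝ × ℝ) | w.1.2 = w.2.2} :=
      isClosed_eq (by fun_prop) (by fun_prop)
    have c2 : IsClosed {w : (ℝ × ℝ) × (ℝ × ℝ) | w.1.1 ≤ w.2.1} :=
      isClosed_le (by fun_prop) (by fun_prop)
    exact c1.inter c2
  have := (hK.image (f := fun w => w.1.2) (by fun_prop)).isClosed
  convert this using 1
  ext u
  constructor
  · rintro ⟨x, x', h, h', hx⟩
    exact ⟨((x, u), (x', u)), ⟨⟨h, h'⟩, rfl, hx⟩, rfl⟩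
  · rintro ⟨⟨⟨x, y⟩, ⟨x', y'⟩⟩, ⟨⟨h, h'⟩, h1, hx⟩, rfl⟩
    simp only at h1 hx h h' ⊢
    subst h1
    exact ⟨x, x', h, h', hx⟩

theorem gr_meet (hf : PlDiag f) {C D : Flag L} {z : ℝ × ℝ} (hC : z ∈ gr f C) (hD : z ∈ gr f D) :
    (∃ e ∈ C, e ∈ D ∧ f e = z) ∨
      ∃ p q, p ∈ C ∧ p ∈ D ∧ q ∈ C ∧ q ∈ D ∧ p ⩿ q ∧ z ∈ segment ℝ (f p) (f q) := by
  obtain ⟨p, hp, q, hq, hpq, hz⟩ := hC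
  obtain ⟨p', hp', q', hq', hpq', hw⟩ := hD
  by_cases he : (p, q) = (p', q')
  · obtain ⟨rfl, rfl⟩ := Prod.mk.inj he
    exact Or.inr ⟨p, q, hp, hp', hq, hq', hpq, hz⟩
  left
  rcases hpq.covBy_or_eq with h1 | rfl <;> rcases hpq'.covBy_or_eq with h2 | rfl
  · obtain ⟨h3, h4⟩ := hf.plan _ _ _ _ h1 h2 he ⟨hz, hw⟩
    have h3' : ∃ e ∈ C, f e = z := by
      rcases h3 with h | h
      · exact ⟨p, hp, h.symm⟩
      · exact ⟨q, hq, h.symm⟩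
    have h4' : ∃ e ∈ D, f e = z := by
      rcases h4 with h | h
      · exact ⟨p', hp', h.symm⟩
      · exact ⟨q', hq', h.symm⟩
    obtain ⟨e, he, rfl⟩ := h3'
    obtain ⟨e', he', h5⟩ := h4'
    exact ⟨e, he, hf.inj h5 ▸ he', rfl⟩
  · simp only [segment_same, Set.mem_singleton_iff] at hw
    subst hw
    rcases hf.nonint _ _ h1 _ hz with h | h
    · exact ⟨p', hf.inj h ▸ hp, hp', rfl⟩
    · exact ⟨p', hf.inj h ▸ hq, hp', rfl⟩
  · simp only [segment_same, Set.mem_singleton_iff] at hz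
    subst hz
    rcases hf.nonint _ _ h2 _ hw with h | h
    · exact ⟨p, hp, hf.inj h ▸ hp', rfl⟩
    · exact ⟨p, hp, hf.inj h ▸ hq', rfl⟩
  · simp only [segment_same, Set.mem_singleton_iff] at hz hw
    subst hz
    exact ⟨p, hp, hf.inj hw ▸ hp', rfl⟩

theorem crossing_le (hf : PlDiag f) {C D : Flag L} {a b : L} (hab : (f a).2 ≤ (f b).2)
    {x1 x1' x2 x2' : ℝ}
    (h1 : (x1, (f a).2) ∈ gr f C) (h1' : (x1', (f a).2) ∈ gr f D) (hlt1 : x1 < x1')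
    (h2 : (x2, (f b).2) ∈ gr f C) (h2' : (x2', (f b).2) ∈ gr f D) (hlt2 : x2' < x2) :
    ∃ e ∈ C, e ∈ D ∧ (f a).2 ≤ (f e).2 ∧ (f e).2 ≤ (f b).2 := by
  have hex : ∀ (E : Flag L), ∀ u ∈ Set.Icc (f a).2 (f b).2, ∃ x, (x, u) ∈ gr f E := by
    intro E u hu
    obtain ⟨m, hm, hmC⟩ := exists_bot_mem a
    obtain ⟨n, hn, hnC⟩ := exists_top_mem b
    exact gr_exists hf E ⟨m, hmC E, (hf.mono.monotone hm).trans hu.1⟩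
      ⟨n, hnC E, hu.2.trans (hf.mono.monotone hn)⟩
  have hpre : IsPreconnected (Set.Icc (f a).2 (f b).2) := isPreconnected_Icc
  rw [isPreconnected_closed_iff] at hpre
  obtain ⟨u, hu, ⟨v, v', hv, hv', hvv⟩, ⟨w', w, hw', hw, hww⟩⟩ :=
    hpre _ _ (le_closed (f := f) C D) (le_closed (f := f) D C)
      (by
        intro u hu
        obtain ⟨x, hx⟩ := hex C u hu
        obtain ⟨x', hx'⟩ := hex D u hu
        rcases le_total x x' with h | h
        · exact Or.inl ⟨x, x', hx, hx', h⟩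
        · exact Or.inr ⟨x', x, hx', hx, h⟩)
      ⟨_, ⟨le_rfl, hab⟩, x1, x1', h1, h1', hlt1.le⟩
      ⟨_, ⟨hab, le_rfl⟩, x2', x2, h2', h2, hlt2.le⟩
  have e1 : v = w := congrArg Prod.fst (gr_uniq hf hv hw rfl)
  have e2 : v' = w' := congrArg Prod.fst (gr_uniq hf hv' hw' rfl)
  have e3 : v = v' := by linarith
  subst e3
  rcases gr_meet hf hv hv' with ⟨e, hC, hD, he⟩ | ⟨p, q, hpC, hpD, hqC, hqD, hpq, hz⟩
  · have : (f e).2 = u := by rw [he]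
    exact ⟨e, hC, hD, this ▸ hu.1, this ▸ hu.2⟩
  · have h3 := seg_snd_mem hz (hf.mono.monotone hpq.le)
    simp only at h3
    by_cases hA : (f a).2 ≤ (f p).2
    · exact ⟨p, hpC, hpD, hA, h3.1.trans hu.2⟩
    by_cases hB : (f q).2 ≤ (f b).2
    · exact ⟨q, hqC, hqD, hu.1.trans h3.2, hB⟩
    push Not at hA hB
    obtain ⟨x, hx⟩ := seg_exists hA.le (hab.trans hB.le)
    have g1 : x1 = x := congrArg Prod.fst (gr_uniq hf h1 ⟨p, hpC, q, hqC, hpq, hx⟩ rfl)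
    have g2 : x1' = x := congrArg Prod.fst (gr_uniq hf h1' ⟨p, hpD, q, hqD, hpq, hx⟩ rfl)
    linarith

theorem crossing (hf : PlDiag f) {C D : Flag L} {a b : L}
    {x1 x1' x2 x2' : ℝ}
    (h1 : (x1, (f a).2) ∈ gr f C) (h1' : (x1', (f a).2) ∈ gr f D) (hlt1 : x1 < x1')
    (h2 : (x2, (f b).2) ∈ gr f C) (h2' : (x2', (f b).2) ∈ gr f D) (hlt2 : x2' < x2) :
    ∃ e ∈ C, e ∈ D ∧ ((f a).2 ≤ (f e).2 ∧ (f e).2 ≤ (f b).2 ∨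
      (f b).2 ≤ (f e).2 ∧ (f e).2 ≤ (f a).2) := by
  rcases le_total (f a).2 (f b).2 with h | h
  · obtain ⟨e, hC, hD, he⟩ := crossing_le hf h h1 h1' hlt1 h2 h2' hlt2
    exact ⟨e, hC, hD, Or.inl he⟩
  · obtain ⟨e, hD, hC, he⟩ := crossing_le hf h h2' h2 hlt2 h1' h1 hlt1
    exact ⟨e, hC, hD, Or.inr he⟩

/-- `a` lies strictly to the left of the chain `C`. -/
def Lft (f : L → ℝ × ℝ) (C : Flag L) (a : L) : Prop :=
  ∃ x, (x, (f a).2) ∈ gr f C ∧ (f a).1 < x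

/-- `a` lies strictly to the right of the chain `C`. -/
def Rgt (f : L → ℝ × ℝ) (C : Flag L) (a : L) : Prop :=
  ∃ x, (x, (f a).2) ∈ gr f C ∧ x < (f a).1

theorem not_lft_rgt (hf : PlDiag f) {C : Flag L} {a : L} (h : Lft f C a) (h' : Rgt f C a) :
    False := by
  obtain ⟨x, hx, hlt⟩ := h
  obtain ⟨x', hx', hlt'⟩ := h'
  have : x = x' := congrArg Prod.fst (gr_uniq hf hx hx' rfl)
  linarith

def Inc (a b : L) : Prop := ¬ a ≤ b ∧ ¬ b ≤ a

theorem Inc.symm {a b : L} (h : Inc a b) : Inc b a := ⟨h.2, h.1⟩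

theorem lft_or_rgt (hf : PlDiag f) {C : Flag L} {a b : L} (hb : b ∈ C) (hab : Inc a b) :
    Lft f C a ∨ Rgt f C a := by
  obtain ⟨x, hx⟩ := gr_at hf C a
  rcases lt_trichotomy (f a).1 x with h | h | h
  · exact Or.inl ⟨x, hx, h⟩
  · exfalso
    have ha : a ∈ C := by
      subst h
      obtain ⟨p, hp, q, hq, hpq, hz⟩ := hx
      rcases hpq.covBy_or_eq with h1 | rfl
      · rcases hf.nonint _ _ h1 a hz with h | h
        · exact hf.inj h ▸ hp
        · exact hf.inj h ▸ hq
      · simp only [segment_same, Set.mem_singleton_iff] at hz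
        exact hf.inj (show f a = f p from hz) ▸ hp
    rcases C.le_or_le ha hb with h | h
    · exact hab.1 h
    · exact hab.2 h
  · exact Or.inr ⟨x, hx, h⟩

theorem meet_comparable (hf : PlDiag f) {C D : Flag L} {a b e : L} (ha : a ∈ D) (hb : b ∈ C)
    (heC : e ∈ C) (heD : e ∈ D) (h : (f a).2 ≤ (f e).2 ∧ (f e).2 ≤ (f b).2 ∨
      (f b).2 ≤ (f e).2 ∧ (f e).2 ≤ (f a).2) (hab : Inc a b) : False := by
  rcases h with ⟨h1, h2⟩ | ⟨h1, h2⟩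
  · exact hab.1 ((chain_le (hf := hf) ha heD h1).trans (chain_le (hf := hf) heC hb h2))
  · exact hab.2 ((chain_le (hf := hf) hb heC h1).trans (chain_le (hf := hf) heD ha h2))

theorem not_lft_lft (hf : PlDiag f) {C D : Flag L} {a b : L} (ha : a ∈ D) (hb : b ∈ C)
    (hab : Inc a b) (h1 : Lft f C a) (h2 : Lft f D b) : False := by
  obtain ⟨x, hx, hlt⟩ := h1
  obtain ⟨x', hx', hlt'⟩ := h2
  obtain ⟨e, heD, heC, he⟩ := crossing hf (mem_gr ha) hx hlt hx' (mem_gr hb) hlt'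
  exact meet_comparable hf ha hb heC heD he hab

theorem not_rgt_rgt (hf : PlDiag f) {C D : Flag L} {a b : L} (ha : a ∈ D) (hb : b ∈ C)
    (hab : Inc a b) (h1 : Rgt f C a) (h2 : Rgt f D b) : False := by
  obtain ⟨x, hx, hlt⟩ := h1
  obtain ⟨x', hx', hlt'⟩ := h2
  obtain ⟨e, heC, heD, he⟩ := crossing hf hx (mem_gr ha) hlt (mem_gr hb) hx' hlt'
  exact meet_comparable hf ha hb heC heD he hab

theorem exists_flag₂ {a b : L} (h : a ≤ b) : ∃ C : Flag L, a ∈ C ∧ b ∈ C := by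
  have : IsChain (· ≤ ·) ({a, b} : Set L) := by
    apply IsChain.pair; exact h
  obtain ⟨C, hC⟩ := this.exists_subset_flag
  exact ⟨C, hC (by simp), hC (by simp)⟩

theorem exists_flag₁ (a : L) : ∃ C : Flag L, a ∈ C := by
  obtain ⟨C, h, _⟩ := exists_flag₂ (le_refl a)
  exact ⟨C, h⟩

def LeftOf (f : L → ℝ × ℝ) (a b : L) : Prop := Inc a b ∧ ∃ C : Flag L, b ∈ C ∧ Lft f C a

theorem LeftOf.rgt (hf : PlDiag f) {a b : L} (h : LeftOf f a b) {D : Flag L} (ha : a ∈ D) :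
    Rgt f D b := by
  obtain ⟨hi, C, hC, hl⟩ := h
  exact (lft_or_rgt hf ha hi.symm).resolve_left fun h => not_lft_lft hf ha hC hi hl h

theorem LeftOf.lft (hf : PlDiag f) {a b : L} (h : LeftOf f a b) {C : Flag L} (hb : b ∈ C) :
    Lft f C a := by
  obtain ⟨D, hD⟩ := exists_flag₁ a
  have := h.rgt hf hD
  exact (lft_or_rgt hf hb h.1).resolve_right fun h' => not_rgt_rgt hf hD hb h.1 h' this

theorem LeftOf.asymm (hf : PlDiag f) {a b : L} (h : LeftOf f a b) (h' : LeftOf f b a) :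
    False := by
  obtain ⟨C, hC⟩ := exists_flag₁ b
  exact not_lft_rgt hf (h.lft hf hC) (h'.rgt hf hC)

theorem LeftOf.total (hf : PlDiag f) {a b : L} (h : Inc a b) : LeftOf f a b ∨ LeftOf f b a := by
  obtain ⟨C, hC⟩ := exists_flag₁ b
  obtain ⟨D, hD⟩ := exists_flag₁ a
  rcases lft_or_rgt hf hC h with h1 | h1
  · exact Or.inl ⟨h, C, hC, h1⟩
  · rcases lft_or_rgt hf hD h.symm with h2 | h2
    · exact Or.inr ⟨h.symm, D, hD, h2⟩
    · exact (not_rgt_rgt hf hD hC h h1 h2).elim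

theorem LeftOf.not_both (hf : PlDiag f) {a b c : L} (hab : a ≤ b ∨ b ≤ a) (h : LeftOf f a c)
    (h' : LeftOf f c b) : False := by
  obtain ⟨C, ha, hb⟩ : ∃ C : Flag L, a ∈ C ∧ b ∈ C := by
    rcases hab with h | h
    · exact exists_flag₂ h
    · obtain ⟨C, h1, h2⟩ := exists_flag₂ h
      exact ⟨C, h2, h1⟩
  exact not_lft_rgt hf (h'.lft hf hb) (h.rgt hf ha)

theorem LeftOf.no_cycle_mid (hf : PlDiag f) {a b c : L} (hab : LeftOf f a b) (hbc : LeftOf f b c)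
    (hca : LeftOf f c a) (hm : (f a).2 ≤ (f b).2 ∧ (f b).2 ≤ (f c).2 ∨
      (f c).2 ≤ (f b).2 ∧ (f b).2 ≤ (f a).2) : False := by
  obtain ⟨A, hA⟩ := exists_flag₁ a
  obtain ⟨C, hC⟩ := exists_flag₁ c
  obtain ⟨x, hx, hlt⟩ := hab.rgt hf hA
  obtain ⟨x', hx', hlt'⟩ := hbc.lft hf hC
  obtain ⟨w, hw, hltw⟩ := hca.lft hf hA
  obtain ⟨e, heA, heC, he⟩ := crossing hf hx hx' (hlt.trans hlt') hw (mem_gr hC) hltw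
  refine meet_comparable hf hA hC heC heA ?_ hca.1.symm
  rcases hm with hm | hm <;> rcases he with he | he
  · left; constructor <;> linarith
  · left; constructor <;> linarith
  · right; constructor <;> linarith
  · right; constructor <;> linarith

theorem LeftOf.no_cycle (hf : PlDiag f) {a b c : L} (hab : LeftOf f a b) (hbc : LeftOf f b c)
    (hca : LeftOf f c a) : False := by
  rcases le_total (f a).2 (f b).2 with h1 | h1 <;> rcases le_total (f b).2 (f c).2 with h2 | h2 <;>
    rcases le_total (f a).2 (f c).2 with h3 | h3 <;>
  first
  | exact hab.no_cycle_mid hf hbc hca (by tauto)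
  | exact hbc.no_cycle_mid hf hca hab (by tauto)
  | exact hca.no_cycle_mid hf hab hbc (by tauto)

theorem LeftOf.trans (hf : PlDiag f) {a b c : L} (hab : LeftOf f a b) (hbc : LeftOf f b c) :
    LeftOf f a c := by
  have hi : Inc a c := ⟨fun h => hab.not_both hf (Or.inl h) hbc |>.elim, 
    fun h => hab.not_both hf (Or.inr h) hbc |>.elim⟩
  rcases LeftOf.total hf hi with h | h
  · exact h
  · exact (hab.no_cycle hf hbc h).elim

end

theorem rank_exists {L : Type*} [Finite L] (R : L → L → Prop) (total : ∀ a b, R a b ∨ R b a)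
    (trans : ∀ a b c, R a b → R b c → R a c) :
    ∃ (n : ℕ) (r : L → Fin n), ∀ a b, R a b ↔ r a ≤ r b := by
  classical
  haveI := Fintype.ofFinite L
  refine ⟨Fintype.card L + 1, fun a => ⟨(Finset.univ.filter fun c => R c a).card,
    Nat.lt_succ_of_le (Finset.card_le_univ _)⟩, fun a b => ?_⟩
  simp only [Fin.mk_le_mk]
  constructor
  · intro h
    apply Finset.card_le_card
    intro c
    simp only [Finset.mem_filter, Finset.mem_univ, true_and]
    exact fun h' => trans _ _ _ h' h
  · intro h
    by_contra hn
    have hba := (total a b).resolve_left hn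
    refine absurd h (not_le.2 (Finset.card_lt_card ?_))
    rw [Finset.ssubset_iff_of_subset]
    · refine ⟨a, ?_, ?_⟩
      · simpa using (total a a)
      · simpa using hn
    · intro c
      simp only [Finset.mem_filter, Finset.mem_univ, true_and]
      exact fun h' => trans _ _ _ h' hba

theorem planar_to_embed {L : Type*} [Lattice L] [Finite L] {f : L → ℝ × ℝ} (hf : PlDiag f) :
    ∃ (m n : ℕ) (g : L → Fin m × Fin n), ∀ p q : L, p ≤ q ↔ g p ≤ g q := by
  have key : ∀ a b : L, ¬ a ≤ b → ¬ b ≤ a → LeftOf f a b ∨ LeftOf f b a :=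
    fun a b h h' => LeftOf.total hf ⟨h, h'⟩
  obtain ⟨m, r, hr⟩ := rank_exists (fun a b : L => a ≤ b ∨ LeftOf f a b)
    (fun a b => by have := key a b; tauto)
    (by
      rintro a b c (h | h) (h' | h')
      · exact Or.inl (h.trans h')
      · by_contra hn
        push Not at hn
        have hi : ¬ c ≤ a := fun hc => h'.1.2 (hc.trans h)
        exact h'.not_both hf (Or.inr h) ((key a c hn.1 hi).resolve_left hn.2)
      · by_contra hn
        push Not at hn
        have hi : ¬ c ≤ a := fun hc => h.1.2 (h'.trans hc)
        exact ((key a c hn.1 hi).resolve_left hn.2).not_both hf (Or.inr h') h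
      · exact Or.inr (h.trans hf h'))
  obtain ⟨n, s, hs⟩ := rank_exists (fun a b : L => a ≤ b ∨ LeftOf f b a)
    (fun a b => by have := key a b; tauto)
    (by
      rintro a b c (h | h) (h' | h')
      · exact Or.inl (h.trans h')
      · by_contra hn
        push Not at hn
        have hi : ¬ c ≤ a := fun hc => h'.1.1 (hc.trans h)
        exact ((key a c hn.1 hi).resolve_right hn.2).not_both hf (Or.inl h) h'
      · by_contra hn
        push Not at hn
        have hi : ¬ c ≤ a := fun hc => h.1.1 (h'.trans hc)
        exact h.not_both hf (Or.inl h') ((key a c hn.1 hi).resolve_right hn.2)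
      · exact Or.inr (h'.trans hf h))
  refine ⟨m, n, fun a => (r a, s a), fun p q => ?_⟩
  rw [Prod.mk_le_mk, ← hr, ← hs]
  constructor
  · exact fun h => ⟨Or.inl h, Or.inl h⟩
  · rintro ⟨h | h, h' | h'⟩
    · exact h
    · exact h
    · exact h'
    · exact (h.asymm hf h').elim

/-- Monotonicity along a segment for a skew order on the plane. -/
theorem seg_skew {P Q z : ℝ × ℝ} (h : z ∈ segment ℝ P Q) (h1 : P.1 ≤ Q.1)
    (h2 : P.2 - P.1 ≤ Q.2 - Q.1) :
    (P.1 ≤ z.1 ∧ P.2 - P.1 ≤ z.2 - z.1) ∧ (z.1 ≤ Q.1 ∧ z.2 - z.1 ≤ Q.2 - Q.1) := by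
  obtain ⟨a, b, ha, hb, hab, rfl⟩ := h
  have : a = 1 - b := by linarith
  subst this
  simp only [Prod.snd_add, Prod.smul_snd, Prod.fst_add, Prod.smul_fst, smul_eq_mul]
  refine ⟨⟨?_, ?_⟩, ?_, ?_⟩ <;> nlinarith

/-- Two segments with a common lower endpoint meeting elsewhere: one contains the other. -/
theorem seg_common {P Q R z : ℝ × ℝ} (hz : z ∈ segment ℝ P Q) (hw : z ∈ segment ℝ P R)
    (hne : z ≠ P) : Q ∈ segment ℝ P R ∨ R ∈ segment ℝ P Q := by
  simp only [segment_eq_image'] at *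
  obtain ⟨s, ⟨hs0, hs1⟩, rfl⟩ := hz
  obtain ⟨t, ⟨ht0, ht1⟩, h⟩ := hw
  simp only [] at h hne
  have hs : 0 < s := by
    rcases hs0.eq_or_lt with rfl | h'
    · simp at hne
    · exact h'
  have ht : 0 < t := by
    rcases ht0.eq_or_lt with rfl | h'
    · exact absurd (by simpa using h.symm) hne
    · exact h'
  have h' : t • (R - P) = s • (Q - P) := by simpa using h
  rcases le_total s t with hst | hst
  · right
    refine ⟨s / t, ⟨by positivity, (div_le_one ht).2 hst⟩, ?_⟩
    simp only []
    rw [div_eq_inv_mul, mul_smul, ← h', smul_smul, inv_mul_cancel₀ ht.ne', one_smul]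
    abel
  · left
    refine ⟨t / s, ⟨by positivity, (div_le_one hs).2 hst⟩, ?_⟩
    simp only []
    rw [div_eq_inv_mul, mul_smul, h', smul_smul, inv_mul_cancel₀ hs.ne', one_smul]
    abel

theorem embed_to_planar {L : Type*} [Lattice L] [Finite L] (f : L → ℝ × ℝ)
    (h : ∀ p q, p ≤ q ↔ (f p).1 ≤ (f q).1 ∧ (f p).2 - (f p).1 ≤ (f q).2 - (f q).1) :
    IsPlanarLattice L := by
  have hinj : Function.Injective f := fun a b hab =>
    le_antisymm ((h _ _).2 (by simp [hab])) ((h _ _).2 (by simp [hab]))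
  have nonint : ∀ p q : L, p ⋖ q → ∀ r : L, f r ∈ segment ℝ (f p) (f q) →
      f r = f p ∨ f r = f q := by
    intro p q hpq r hr
    have h0 := (h _ _).1 hpq.le
    obtain ⟨h1, h2⟩ := seg_skew hr h0.1 h0.2
    rcases hpq.wcovBy.eq_or_eq ((h _ _).2 h1) ((h _ _).2 h2) with h | h <;> simp [h]
  refine ⟨f, hinj, ?_, nonint, ?_⟩
  · intro p q hpq
    have h0 := (h _ _).1 hpq.le
    by_contra hn
    exact hpq.lt.not_ge ((h _ _).2 ⟨by linarith, by linarith⟩)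
  · rintro p q p' q' hpq hpq' hne z ⟨hz, hw⟩
    have h0 := (h _ _).1 hpq.le
    have h0' := (h _ _).1 hpq'.le
    obtain ⟨h1, h2⟩ := seg_skew hz h0.1 h0.2
    obtain ⟨h1', h2'⟩ := seg_skew hw h0'.1 h0'.2
    have l1 : p ≤ q' := (h _ _).2 ⟨h1.1.trans h2'.1, h1.2.trans h2'.2⟩
    have l2 : p' ≤ q := (h _ _).2 ⟨h1'.1.trans h2.1, h1'.2.trans h2.2⟩
    have m1 := hpq.wcovBy.eq_or_eq (le_sup_left : p ≤ p ⊔ p') (sup_le hpq.le l2)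
    have m2 := hpq'.wcovBy.eq_or_eq (le_sup_right : p' ≤ p ⊔ p') (sup_le l1 hpq'.le)
    have eqz : ∀ r, ((f r).1 ≤ z.1 ∧ (f r).2 - (f r).1 ≤ z.2 - z.1) →
        (z.1 ≤ (f r).1 ∧ z.2 - z.1 ≤ (f r).2 - (f r).1) → z = f r := by
      intro r ha hb
      ext <;> linarith
    rcases m1 with m1 | m1 <;> rcases m2 with m2 | m2
    · obtain rfl : p = p' := m1.symm.trans m2
      by_cases hzp : z = f p
      · simp [hzp]
      exfalso
      apply hne
      rcases seg_common hz hw hzp with hs | hs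
      · rcases nonint _ _ hpq' _ hs with e | e
        · exact absurd (hinj e) hpq.ne'
        · rw [hinj e]
      · rcases nonint _ _ hpq _ hs with e | e
        · exact absurd (hinj e) hpq'.ne'
        · rw [hinj e]
    · obtain rfl : p = q' := m1.symm.trans m2
      simp [eqz p h1 h2']
    · obtain rfl : q = p' := m1.symm.trans m2
      simp [eqz q h1' h2]
    · obtain rfl : q = q' := m1.symm.trans m2
      by_cases hzp : z = f q
      · simp [hzp]
      exfalso
      apply hne
      rw [segment_symm] at hz hw
      rcases seg_common hz hw hzp with hs | hs
      · rw [segment_symm] at hs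
        rcases nonint _ _ hpq' _ hs with e | e
        · rw [hinj e]
        · exact absurd (hinj e) hpq.ne
      · rw [segment_symm] at hs
        rcases nonint _ _ hpq _ hs with e | e
        · rw [hinj e]
        · exact absurd (hinj e) hpq'.ne

/-- A finite lattice `L` is planar iff it order-embeds into the direct product of two finite
chains, with the componentwise order. -/
theorem planar_iff_embeds_in_product_of_chains {L : Type*} [Lattice L] [Finite L] :
    IsPlanarLattice L ↔
      ∃ (C₁ C₂ : Type) (_ : LinearOrder C₁) (_ : LinearOrder C₂)
        (_ : Finite C₁) (_ : Finite C₂) (f : L → C₁ × C₂),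
        ∀ p q : L, p ≤ q ↔ f p ≤ f q := by
  constructor
  · rintro ⟨f, h1, h2, h3, h4⟩
    obtain ⟨m, n, g, hg⟩ := planar_to_embed (PlDiag.mk h1 h2 h3 h4)
    exact ⟨Fin m, Fin n, inferInstance, inferInstance, inferInstance, inferInstance, g, hg⟩
  · rintro ⟨C₁, C₂, i₁, i₂, f₁, f₂, g, hg⟩
    obtain ⟨m, r, hr⟩ := rank_exists (fun a b : C₁ => a ≤ b) le_total (fun _ _ _ => le_trans)
    obtain ⟨n, s, hs⟩ := rank_exists (fun a b : C₂ => a ≤ b) le_total (fun _ _ _ => le_trans)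
    refine embed_to_planar (fun a => (((r (g a).1 : ℕ) : ℝ),
      ((r (g a).1 : ℕ) : ℝ) + ((s (g a).2 : ℕ) : ℝ))) fun p q => ?_
    rw [hg, Prod.le_def, hr, hs]
    simp only [add_sub_cancel_left, Nat.cast_le, Fin.val_fin_le]
end

section
/- A finite lattice L admits a strict order complementary to its lattice order if and only if the strict order of L is the intersection of two strict linear orders on L. -/
theorem union_strictLinear {P : Type*} (r s : P → P → Prop)
    (hr : IsStrictOrderRel r) (hs : IsStrictOrderRel s) (h : ComplementaryTo r s) :
    IsStrictLinearOrderRel (fun a b => r a b ∨ s a b) := by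
  obtain ⟨ri, rt⟩ := hr
  obtain ⟨si, st⟩ := hs
  have ht : ∀ a b, a ≠ b → (r a b ∨ r b a) ∨ (s a b ∨ s b a) := by
    intro a b hab
    rcases h a b hab with h | h
    · exact Or.inl h.1
    · exact Or.inr h.1
  have hd : ∀ a b, (r a b ∨ r b a) → (s a b ∨ s b a) → False := by
    intro a b h1 h2
    by_cases hab : a = b
    · subst hab
      rcases h1 with h1 | h1 <;> exact ri _ h1
    · rcases h a b hab with h | h
      · exact h.2 h2
      · exact h.2 h1
  refine ⟨fun a h => h.elim (ri a) (si a), ?_, ?_⟩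
  · rintro a b c (h1 | h1) (h2 | h2)
    · exact Or.inl (rt _ _ _ h1 h2)
    · have hne : a ≠ c := by
        rintro rfl
        exact hd a b (Or.inl h1) (Or.inr h2)
      rcases ht a c hne with (h3 | h3) | (h3 | h3)
      · exact Or.inl h3
      · exact (hd c b (Or.inl (rt _ _ _ h3 h1)) (Or.inr h2)).elim
      · exact Or.inr h3
      · exact (hd a b (Or.inl h1) (Or.inr (st _ _ _ h2 h3))).elim
    · have hne : a ≠ c := by
        rintro rfl
        exact hd a b (Or.inr h2) (Or.inl h1)
      rcases ht a c hne with (h3 | h3) | (h3 | h3)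
      · exact Or.inl h3
      · exact (hd a b (Or.inr (rt _ _ _ h2 h3)) (Or.inl h1)).elim
      · exact Or.inr h3
      · exact (hd c b (Or.inr h2) (Or.inl (st _ _ _ h3 h1))).elim
    · exact Or.inr (st _ _ _ h1 h2)
  · intro a b hab
    have := ht a b hab
    tauto

/-- A finite lattice admits a strict order complementary to its lattice order iff its strict
order is the intersection of two strict linear orders. -/
theorem complementary_iff_dimension_le_two {L : Type*} [Lattice L] [Finite L] :
    (∃ lam : L → L → Prop,
        IsStrictOrderRel lam ∧ ComplementaryTo (· < · : L → L → Prop) lam) ↔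
      ∃ t₁ t₂ : L → L → Prop, IsStrictLinearOrderRel t₁ ∧ IsStrictLinearOrderRel t₂ ∧
        ∀ a b : L, a < b ↔ t₁ a b ∧ t₂ a b := by
  constructor
  · rintro ⟨lam, hl, hc⟩
    have hlt : IsStrictOrderRel (· < · : L → L → Prop) :=
      ⟨fun a => lt_irrefl a, fun a b c => lt_trans⟩
    have hl' : IsStrictOrderRel (fun a b => lam b a) :=
      ⟨hl.1, fun a b c h1 h2 => hl.2 c b a h2 h1⟩
    have hc' : ComplementaryTo (· < · : L → L → Prop) (fun a b => lam b a) := by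
      intro a b hab
      have := hc b a hab.symm
      rwa [or_comm (a := b < a)] at this
    refine ⟨_, _, union_strictLinear _ _ hlt hl hc, union_strictLinear _ _ hlt hl' hc', ?_⟩
    intro a b
    refine ⟨fun h => ⟨Or.inl h, Or.inl h⟩, ?_⟩
    rintro ⟨h1 | h1, h2 | h2⟩
    · exact h1
    · exact h1
    · exact h2
    · exact (hl.1 _ (hl.2 _ _ _ h1 h2)).elim
  · rintro ⟨t₁, t₂, ⟨i1, tr1, c1⟩, ⟨i2, tr2, c2⟩, h⟩
    refine ⟨fun a b => t₁ a b ∧ t₂ b a, ⟨fun a h => i1 a h.1, fun a b c h1 h2 =>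
      ⟨tr1 _ _ _ h1.1 h2.1, tr2 _ _ _ h2.2 h1.2⟩⟩, ?_⟩
    intro a b hab
    have e1 := c1 a b hab
    have e2 := c2 a b hab
    have n1 : ¬ (t₁ a b ∧ t₁ b a) := fun h => i1 _ (tr1 _ _ _ h.1 h.2)
    have n2 : ¬ (t₂ a b ∧ t₂ b a) := fun h => i2 _ (tr2 _ _ _ h.1 h.2)
    simp only [h, Xor']
    tauto
end

section
/- A finite lattice L admits a strict order complementary to its lattice order if and only if there exist two finite linearly ordered sets C₁ and C₂ and an order embedding of L into C₁ × C₂ with the componentwise (product) order. -/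
theorem rank_aux {L : Type*} [PartialOrder L] [Finite L] (lam : L → L → Prop)
    (h : IsStrictOrderRel lam) (hc : ComplementaryTo (· < · : L → L → Prop) lam) :
    ∃ f : L → Fin (Nat.card L + 1), ∀ p q, f p ≤ f q ↔ ¬ (q < p ∨ lam q p) := by
  obtain ⟨hi, ht⟩ := h
  have hex : ∀ a b, a < b → lam a b ∨ lam b a → False := by
    intro a b hab hl
    rcases hc a b hab.ne with h | h
    · exact h.2 hl
    · exact h.2 (Or.inl hab)
  have htot : ∀ a b, a ≠ b → (a < b ∨ lam a b) ∨ (b < a ∨ lam b a) := by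
    intro a b hab
    rcases hc a b hab with h | h <;> have := h.1 <;> tauto
  have hirr : ∀ a, ¬ (a < a ∨ lam a a) := by
    intro a h
    rcases h with h | h
    · exact lt_irrefl _ h
    · exact hi _ h
  have htr : ∀ a b c, (a < b ∨ lam a b) → (b < c ∨ lam b c) → (a < c ∨ lam a c) := by
    intro a b c hab hbc
    by_cases hac : a = c
    · subst hac
      rcases hab with hab | hab <;> rcases hbc with hbc | hbc
      · exact Or.inl (hab.trans hbc)
      · exact (hex _ _ hab (Or.inr hbc)).elim
      · exact (hex _ _ hbc (Or.inr hab)).elim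
      · exact Or.inr (ht _ _ _ hab hbc)
    · rcases htot a c hac with h | h
      · exact h
      · exfalso
        rcases hab with hab | hab <;> rcases hbc with hbc | hbc <;> rcases h with h | h
        · exact lt_irrefl _ ((hab.trans hbc).trans h)
        · exact hex _ _ (hab.trans hbc) (Or.inr h)
        · exact hex _ _ (h.trans hab) (Or.inr hbc)
        · exact hex _ _ hab (Or.inr (ht _ _ _ hbc h))
        · exact hex _ _ (hbc.trans h) (Or.inr hab)
        · exact hex _ _ hbc (Or.inr (ht _ _ _ h hab))
        · exact hex _ _ h (Or.inr (ht _ _ _ hab hbc))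
        · exact hi _ (ht _ _ _ (ht _ _ _ hab hbc) h)
  have hlt : ∀ a b, (a < b ∨ lam a b) →
      {c | c < a ∨ lam c a}.ncard < {c | c < b ∨ lam c b}.ncard := by
    intro a b hab
    apply Set.ncard_lt_ncard _ (Set.toFinite _)
    refine ⟨fun c hc => htr _ _ _ hc hab, fun hs => hirr a (hs hab)⟩
  refine ⟨fun a => ⟨{c | c < a ∨ lam c a}.ncard, Nat.lt_succ_of_le (Set.ncard_le_card _)⟩, ?_⟩
  intro p q
  rw [Fin.mk_le_mk]
  constructor
  · intro hle hqp
    exact absurd (hlt _ _ hqp) (not_lt.mpr hle)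
  · intro hn
    by_cases hpq : p = q
    · rw [hpq]
    · rcases htot p q hpq with h | h
      · exact (hlt _ _ h).le
      · exact (hn h).elim

/-- A finite lattice admits a strict order complementary to its lattice order iff it
order-embeds into the direct product of two finite chains, with the componentwise order. -/
theorem complementary_iff_embeds_in_product_of_chains {L : Type*} [Lattice L] [Finite L] :
    (∃ lam : L → L → Prop,
        IsStrictOrderRel lam ∧ ComplementaryTo (· < · : L → L → Prop) lam) ↔
      ∃ (C₁ C₂ : Type) (_ : LinearOrder C₁) (_ : LinearOrder C₂)
        (_ : Finite C₁) (_ : Finite C₂) (f : L → C₁ × C₂),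
        ∀ p q : L, p ≤ q ↔ f p ≤ f q := by
  constructor
  · rintro ⟨lam, h, hc⟩
    obtain ⟨f, hf⟩ := rank_aux lam h hc
    obtain ⟨g, hg⟩ := rank_aux (fun a b => lam b a)
      ⟨h.1, fun a b c h1 h2 => h.2 _ _ _ h2 h1⟩
      (fun a b hab => by
        have := hc a b hab
        rwa [or_comm (a := lam a b)] at this)
    refine ⟨_, _, inferInstance, inferInstance, inferInstance, inferInstance,
      fun a => (f a, g a), fun p q => ?_⟩
    rw [Prod.mk_le_mk, hf, hg]
    by_cases hpq : p = q
    · subst hpq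
      simp [h.1]
    · have h1 := hc p q hpq
      have h2 : p ≤ q ↔ p < q := ⟨fun h => lt_of_le_of_ne h hpq, le_of_lt⟩
      have h3 : p < q → ¬ q < p := fun h => h.asymm
      rw [h2]
      rcases h1 with h1 | h1 <;> have h4 := h1.1 <;> have h5 := h1.2 <;> clear h1 <;> tauto
  · rintro ⟨C₁, C₂, _, _, _, _, f, hf⟩
    refine ⟨fun p q => (f p).1 < (f q).1 ∧ (f q).2 < (f p).2, ⟨?_, ?_⟩, ?_⟩
    · intro a h
      exact lt_irrefl _ h.1
    · intro a b c h1 h2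
      exact ⟨h1.1.trans h2.1, h2.2.trans h1.2⟩
    · intro a b hab
      have hne : ¬ (a ≤ b ∧ b ≤ a) := fun h => hab (le_antisymm h.1 h.2)
      simp only [lt_iff_le_not_ge (α := L)]
      simp only [hf, Prod.le_def] at hne ⊢
      simp only [← not_le]
      have t1 := le_total (f a).1 (f b).1
      have t2 := le_total (f a).2 (f b).2
      unfold Xor'
      tauto
end

section
/- If ρ and λ are complementary strict orders on a set P, and λ̃ denotes the dual of λ (a λ̃ b iff b λ a), then ρ ∪ λ̃ is a strict linear order on P, and the intersection of the two relations ρ ∪ λ and ρ ∪ λ̃ is exactly ρ. -/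
/-- If `ρ` and `lam` are complementary strict orders on a set `P` and `lam̃` is the dual of
`lam`, then `ρ ∪ lam̃` is a strict linear order on `P`, and the intersection of `ρ ∪ lam`
and `ρ ∪ lam̃` is exactly `ρ`. -/
theorem union_with_dual_is_strict_linear_order_and_intersection
    {P : Type*} (ρ lam : P → P → Prop)
    (hρ : IsStrictOrderRel ρ) (hlam : IsStrictOrderRel lam)
    (hcomp : ∀ a b : P, a ≠ b → Xor' (ρ a b ∨ ρ b a) (lam a b ∨ lam b a)) :
    IsStrictLinearOrderRel (fun a b => ρ a b ∨ lam b a) ∧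
      ∀ a b : P, ((ρ a b ∨ lam a b) ∧ (ρ a b ∨ lam b a)) ↔ ρ a b := by
  obtain ⟨ri, rt⟩ := hρ
  obtain ⟨li, lt⟩ := hlam
  have ex : ∀ a b : P, (ρ a b ∨ ρ b a) → (lam a b ∨ lam b a) → False := by
    intro a b h1 h2
    have hne : a ≠ b := by
      rintro rfl
      exact ri a (h1.elim id id)
    rcases hcomp a b hne with ⟨_, h⟩ | ⟨_, h⟩
    · exact h h2
    · exact h h1
  have tot : ∀ a b : P, a ≠ b → (ρ a b ∨ ρ b a) ∨ (lam a b ∨ lam b a) := by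
    intro a b hne
    rcases hcomp a b hne with ⟨h, _⟩ | ⟨h, _⟩
    · exact Or.inl h
    · exact Or.inr h
  refine ⟨⟨fun a h => h.elim (ri a) (li a), ?_, ?_⟩, ?_⟩
  · rintro a b c (h1 | h1) (h2 | h2)
    · exact Or.inl (rt _ _ _ h1 h2)
    · by_cases hac : a = c
      · subst hac
        exact (ex a b (Or.inl h1) (Or.inl h2)).elim
      · rcases tot a c hac with (h | h) | (h | h)
        · exact Or.inl h
        · exact (ex c b (Or.inl (rt _ _ _ h h1)) (Or.inl h2)).elim
        · exact (ex a b (Or.inl h1) (Or.inl (lt _ _ _ h h2))).elim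
        · exact Or.inr h
    · by_cases hac : a = c
      · subst hac
        exact (ex b a (Or.inl h2) (Or.inl h1)).elim
      · rcases tot a c hac with (h | h) | (h | h)
        · exact Or.inl h
        · exact (ex b a (Or.inl (rt _ _ _ h2 h)) (Or.inl h1)).elim
        · exact (ex b c (Or.inl h2) (Or.inl (lt _ _ _ h1 h))).elim
        · exact Or.inr h
    · exact Or.inr (lt _ _ _ h2 h1)
  · intro a b hne
    have := tot a b hne
    tauto
  · intro a b
    constructor
    · rintro ⟨h1 | h1, h2 | h2⟩
      · exact h1
      · exact h1
      · exact h2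
      · exact (li a (lt _ _ _ h1 h2)).elim
    · exact fun h => ⟨Or.inl h, Or.inl h⟩
end

section
/- Let L be a finite subset of ℝ² equipped with the order induced from the product order of ℝ², and suppose that L with this order is a lattice in its own right (every two elements of L have a least upper bound and a greatest lower bound within L, not necessarily computed coordinatewise). Then for any two distinct covering pairs p ⋖ q and p' ⋖ q' in L, the intersection of the closed segment from p to q with the closed segment from p' to q' is contained in {p, q} ∩ {p', q'}; that is, distinct covering segments intersect only at common endpoints, if at all. -/
/-- Two increasing segments from `p` meeting away from `p` have comparable tops. -/
theorem comparable_tops {p q r x : ℝ × ℝ} (hq : p ≤ q) (hr : p ≤ r)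
    (h1 : x ∈ segment ℝ p q) (h2 : x ∈ segment ℝ p r) (hx : x ≠ p) : q ≤ r ∨ r ≤ q := by
  obtain ⟨a, b, ha, hb, hab, e⟩ := h1
  obtain ⟨c, d, hc, hd, hcd, f⟩ := h2
  have key : ∀ {u v y : ℝ × ℝ} {s t : ℝ}, p ≤ v → 0 ≤ s → s ≤ t → x ≠ p →
      (1 - s) • p + s • u = x → (1 - t) • p + t • v = x → v ≤ u := by
    intro u v y s t hv hs hst hx h1 h2
    have hs' : 0 < s := by
      rcases hs.eq_or_lt with h | h
      · subst h
        exact absurd (by simpa using h1.symm) hx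
      · exact h
    have e1 := congrArg Prod.fst (h1.trans h2.symm)
    have e2 := congrArg Prod.snd (h1.trans h2.symm)
    simp at e1 e2
    obtain ⟨v1, v2⟩ := hv
    constructor
    · refine le_of_mul_le_mul_left (a := s) ?_ hs'
      nlinarith [mul_nonneg (sub_nonneg.2 hst) (sub_nonneg.2 v1)]
    · refine le_of_mul_le_mul_left (a := s) ?_ hs'
      nlinarith [mul_nonneg (sub_nonneg.2 hst) (sub_nonneg.2 v2)]
  obtain rfl : a = 1 - b := by linarith
  obtain rfl : c = 1 - d := by linarith
  rcases le_total b d with h | h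
  · exact Or.inr (key (y := x) hr hb h hx e f)
  · exact Or.inl (key (y := x) hq hd h hx f e)

theorem neg_mem_segment {p q x : ℝ × ℝ} (h : x ∈ segment ℝ p q) :
    -x ∈ segment ℝ (-q) (-p) := by
  obtain ⟨a, b, ha, hb, hab, rfl⟩ := h
  exact ⟨b, a, hb, ha, by linarith, by simp only [smul_neg]; abel⟩

theorem mem_segment_bounds {p q x : ℝ × ℝ} (hpq : p ≤ q) (h : x ∈ segment ℝ p q) :
    p ≤ x ∧ x ≤ q := segment_subset_Icc hpq h

/-- **Planarity in the product order on `ℝ²`.** Let `L` be a finite subset of `ℝ²` with the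
order induced from the product order, which is a lattice in its own right (every two elements
of `L` have a least upper bound and a greatest lower bound within `L`). Then distinct
covering segments of `L` intersect only at common endpoints, if at all. -/
theorem planarity_of_product_order (L : Set (ℝ × ℝ)) (hfin : L.Finite)
    (hsup : ∀ a ∈ L, ∀ b ∈ L, ∃ s ∈ L, a ≤ s ∧ b ≤ s ∧ ∀ t ∈ L, a ≤ t → b ≤ t → s ≤ t)
    (hinf : ∀ a ∈ L, ∀ b ∈ L, ∃ s ∈ L, s ≤ a ∧ s ≤ b ∧ ∀ t ∈ L, t ≤ a → t ≤ b → t ≤ s)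
    {p q p' q' : ℝ × ℝ} (hp : p ∈ L) (hq : q ∈ L) (hp' : p' ∈ L) (hq' : q' ∈ L)
    (hpq : p < q) (hcov : ∀ r ∈ L, ¬(p < r ∧ r < q))
    (hpq' : p' < q') (hcov' : ∀ r ∈ L, ¬(p' < r ∧ r < q'))
    (hne : (p, q) ≠ (p', q')) :
    segment ℝ p q ∩ segment ℝ p' q' ⊆ ({p, q} ∩ {p', q'} : Set (ℝ × ℝ)) := by
  rintro x ⟨h1, h2⟩
  obtain ⟨hpx, hxq⟩ := mem_segment_bounds hpq.le h1
  obtain ⟨hpx', hxq'⟩ := mem_segment_bounds hpq'.le h2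
  obtain ⟨s, hs, hps, hps', hl⟩ := hsup p hp p' hp'
  have hsq := hl q hq (hpx.trans hxq) (hpx'.trans hxq)
  have hsq' := hl q' hq' (hpx.trans hxq') (hpx'.trans hxq')
  have c1 : p = s ∨ s = q := by
    by_contra! h
    exact hcov s hs ⟨lt_of_le_of_ne hps h.1, lt_of_le_of_ne hsq h.2⟩
  have c2 : p' = s ∨ s = q' := by
    by_contra! h
    exact hcov' s hs ⟨lt_of_le_of_ne hps' h.1, lt_of_le_of_ne hsq' h.2⟩
  rcases c1 with rfl | rfl <;> rcases c2 with rfl | rfl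
  · by_cases hx : x = p'
    · simp [hx]
    · exfalso
      have hn : q ≠ q' := fun h => hne (by rw [h])
      rcases comparable_tops hpq.le hpq'.le h1 h2 hx with h | h
      · exact hcov' q hq ⟨hpq, lt_of_le_of_ne h hn⟩
      · exact hcov q' hq' ⟨hpq', lt_of_le_of_ne h hn.symm⟩
  · have := le_antisymm hpx hxq'
    simp [← this]
  · have := le_antisymm hpx' hxq
    simp [← this]
  · by_cases hx : x = s
    · simp [hx]
    · exfalso
      have hn : p ≠ p' := fun h => hne (by rw [h])
      rcases comparable_tops (neg_le_neg hpq.le) (neg_le_neg hpq'.le) (neg_mem_segment h1)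
        (neg_mem_segment h2) (fun h => hx (neg_injective h)) with h | h
      · exact hcov' p hp ⟨lt_of_le_of_ne (neg_le_neg_iff.1 h) hn.symm, hpq⟩
      · exact hcov p' hp' ⟨lt_of_le_of_ne (neg_le_neg_iff.1 h) hn, hpq'⟩
end

section
/- Let L be a finite subset of ℝ² equipped with the order induced from the product order of ℝ², and suppose that L with this order is a lattice in its own right. Let β : ℝ² → ℝ² be given by β(x, y) = ((x − y)/2, (x + y)/2). Then β restricted to L is an order isomorphism from L with the product order onto β(L) with the induced slanted order, and β(L) is a planar lattice diagram: for every covering pair p' ⋖ q' of β(L) in the slanted order, the second coordinate of p' is strictly less than that of q', the closed segment from p' to q' meets β(L) only in p' and q', and for any two distinct covering pairs the corresponding closed segments intersect only in common endpoints. -/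
/-- The slanted strict order on `ℝ²`: `p <ₛ q` iff `p ≠ q` and `|q₁ − p₁| ≤ q₂ − p₂`. -/
def SlantedLt (p q : ℝ × ℝ) : Prop := p ≠ q ∧ |q.1 - p.1| ≤ q.2 - p.2

/-- The reflexive closure of the slanted order. -/
def SlantedLe (p q : ℝ × ℝ) : Prop := p = q ∨ SlantedLt p q

/-- The scaled rotation `β(x, y) = ((x − y)/2, (x + y)/2)` taking product order to slanted
order. -/
noncomputable def betaMap (v : ℝ × ℝ) : ℝ × ℝ := ((v.1 - v.2) / 2, (v.1 + v.2) / 2)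

/-- The linear map underlying `betaMap`. -/
noncomputable def betaLin : (ℝ × ℝ) →ₗ[ℝ] (ℝ × ℝ) where
  toFun := betaMap
  map_add' x y := by
    ext <;> simp [betaMap] <;> ring
  map_smul' c x := by
    ext <;> simp [betaMap] <;> ring

theorem betaMap_inj : Function.Injective betaMap := by
  rintro ⟨a, b⟩ ⟨c, d⟩ h
  simp only [betaMap, Prod.mk.injEq] at h ⊢
  obtain ⟨h1, h2⟩ := h
  constructor <;> linarith

theorem slantedLt_beta (a b : ℝ × ℝ) : SlantedLt (betaMap a) (betaMap b) ↔ a < b := by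
  rw [lt_iff_le_and_ne, and_comm, SlantedLt, betaMap_inj.ne_iff]
  refine and_congr_right fun _ => ?_
  simp only [betaMap, abs_le, Prod.le_def]
  constructor
  · rintro ⟨h1, h2⟩
    constructor <;> linarith
  · rintro ⟨h1, h2⟩
    constructor <;> linarith

theorem segment_beta (a b : ℝ × ℝ) :
    segment ℝ (betaMap a) (betaMap b) = betaMap '' segment ℝ a b :=
  (image_segment ℝ betaLin.toAffineMap a b).symm

theorem mem_seg_bounds {a b z : ℝ × ℝ} (h : a ≤ b) (hz : z ∈ segment ℝ a b) :
    a ≤ z ∧ z ≤ b :=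
  segment_subset_Icc h hz

theorem ray_aux {p q r : ℝ × ℝ} {s t : ℝ} (hpq : p ≤ q) (hs : s ≤ t) (ht : 0 < t)
    (h : s • (q - p) = t • (r - p)) : r ≤ q := by
  have h1 := congrArg Prod.fst h
  have h2 := congrArg Prod.snd h
  simp only [Prod.smul_fst, Prod.smul_snd, Prod.fst_sub, Prod.snd_sub, smul_eq_mul] at h1 h2
  have k1 := mul_le_mul_of_nonneg_right hs (sub_nonneg.2 hpq.1)
  have k2 := mul_le_mul_of_nonneg_right hs (sub_nonneg.2 hpq.2)
  rw [h1] at k1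
  rw [h2] at k2
  have l1 := le_of_mul_le_mul_left k1 ht
  have l2 := le_of_mul_le_mul_left k2 ht
  exact ⟨by linarith, by linarith⟩

/-- Two upward segments from a common bottom that meet elsewhere have comparable tops. -/
theorem ray_bot {p q r z : ℝ × ℝ} (hpq : p ≤ q) (hpr : p ≤ r)
    (h1 : z ∈ segment ℝ p q) (h2 : z ∈ segment ℝ p r) (hz : z ≠ p) : r ≤ q ∨ q ≤ r := by
  rw [segment_eq_image'] at h1 h2
  obtain ⟨s, ⟨hs0, -⟩, hs⟩ := h1
  obtain ⟨t, ⟨ht0, -⟩, ht⟩ := h2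
  have hs' : 0 < s := lt_of_le_of_ne hs0 (by rintro rfl; exact hz (by simp [← hs]))
  have ht' : 0 < t := lt_of_le_of_ne ht0 (by rintro rfl; exact hz (by simp [← ht]))
  have e : s • (q - p) = t • (r - p) := add_left_cancel (hs.trans ht.symm)
  rcases le_total s t with h | h
  · exact Or.inl (ray_aux hpq h ht' e)
  · exact Or.inr (ray_aux hpr h hs' e.symm)

/-- Two upward segments to a common top that meet elsewhere have comparable bottoms. -/
theorem ray_top {p q r z : ℝ × ℝ} (hpq : q ≤ p) (hpr : r ≤ p)
    (h1 : z ∈ segment ℝ q p) (h2 : z ∈ segment ℝ r p) (hz : z ≠ p) : q ≤ r ∨ r ≤ q := by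
  have key : ∀ a : ℝ × ℝ, z ∈ segment ℝ a p → -z ∈ segment ℝ (-p) (-a) := by
    rintro a ⟨s, t, hs, ht, hst, rfl⟩
    exact ⟨t, s, ht, hs, by linarith, by simp [smul_neg]⟩
  have := ray_bot (neg_le_neg hpq) (neg_le_neg hpr) (key q h1) (key r h2)
    (fun h => hz (neg_injective h))
  simpa using this

theorem core_planar (L : Set (ℝ × ℝ))
    (hsup : ∀ a ∈ L, ∀ b ∈ L, ∃ s ∈ L, a ≤ s ∧ b ≤ s ∧ ∀ t ∈ L, a ≤ t → b ≤ t → s ≤ t)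
    {p₁ q₁ p₂ q₂ z : ℝ × ℝ} (hp₁ : p₁ ∈ L) (hq₁ : q₁ ∈ L) (hp₂ : p₂ ∈ L) (hq₂ : q₂ ∈ L)
    (h₁ : p₁ < q₁) (c₁ : ∀ r ∈ L, p₁ ≤ r → r ≤ q₁ → r = p₁ ∨ r = q₁)
    (h₂ : p₂ < q₂) (c₂ : ∀ r ∈ L, p₂ ≤ r → r ≤ q₂ → r = p₂ ∨ r = q₂)
    (hne : ¬(p₁ = p₂ ∧ q₁ = q₂))
    (z₁ : z ∈ segment ℝ p₁ q₁) (z₂ : z ∈ segment ℝ p₂ q₂) :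
    (z = p₁ ∨ z = q₁) ∧ (z = p₂ ∨ z = q₂) := by
  obtain ⟨b1, b2⟩ := mem_seg_bounds h₁.le z₁
  obtain ⟨b3, b4⟩ := mem_seg_bounds h₂.le z₂
  obtain ⟨s, hs, s1, s2, s3⟩ := hsup p₁ hp₁ p₂ hp₂
  have t1 := s3 q₁ hq₁ h₁.le (b3.trans b2)
  have t2 := s3 q₂ hq₂ (b1.trans b4) h₂.le
  rcases c₁ s hs s1 t1 with e1 | e1 <;> rcases c₂ s hs s2 t2 with e2 | e2
  · obtain rfl : p₁ = p₂ := e1.symm.trans e2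
    by_cases hz : z = p₁
    · exact ⟨Or.inl hz, Or.inl hz⟩
    · exfalso
      rcases ray_bot h₁.le h₂.le z₁ z₂ hz with h | h
      · rcases c₁ q₂ hq₂ h₂.le h with h' | h'
        · exact h₂.ne' h'
        · exact hne ⟨rfl, h'.symm⟩
      · rcases c₂ q₁ hq₁ h₁.le h with h' | h'
        · exact h₁.ne' h'
        · exact hne ⟨rfl, h'⟩
  · obtain rfl : p₁ = q₂ := e1.symm.trans e2
    have := le_antisymm b4 b1
    exact ⟨Or.inl this, Or.inr this⟩
  · obtain rfl : q₁ = p₂ := e1.symm.trans e2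
    have := le_antisymm b2 b3
    exact ⟨Or.inr this, Or.inl this⟩
  · obtain rfl : q₁ = q₂ := e1.symm.trans e2
    by_cases hz : z = q₁
    · exact ⟨Or.inr hz, Or.inr hz⟩
    · exfalso
      rcases ray_top h₁.le h₂.le z₁ z₂ hz with h | h
      · rcases c₁ p₂ hp₂ h h₂.le with h' | h'
        · exact hne ⟨h'.symm, rfl⟩
        · exact h₂.ne h'
      · rcases c₂ p₁ hp₁ h h₁.le with h' | h'
        · exact hne ⟨h', rfl⟩
        · exact h₁.ne h'

theorem cover_beta {L : Set (ℝ × ℝ)} {p q : ℝ × ℝ}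
    (h : ∀ r ∈ betaMap '' L, ¬(SlantedLt (betaMap p) r ∧ SlantedLt r (betaMap q))) :
    ∀ r ∈ L, p ≤ r → r ≤ q → r = p ∨ r = q := by
  intro r hr h1 h2
  by_contra hc
  push Not at hc
  refine h _ ⟨r, hr, rfl⟩ ?_
  rw [slantedLt_beta, slantedLt_beta]
  exact ⟨lt_of_le_of_ne h1 hc.1.symm, lt_of_le_of_ne h2 hc.2⟩

/-- Let `L` be a finite subset of `ℝ²` with the order induced from the product order, which
is a lattice in its own right.  Then `β` restricted to `L` is an order isomorphism from `L`
with the product order onto `β(L)` with the induced slanted order, and `β(L)` is a planar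
lattice diagram: coverings in the slanted order are `y`-isotone, covering segments meet
`β(L)` only at their endpoints, and distinct covering segments intersect only in common
endpoints. -/
theorem betaMap_gives_planar_diagram (L : Set (ℝ × ℝ)) (hfin : L.Finite)
    (hsup : ∀ a ∈ L, ∀ b ∈ L, ∃ s ∈ L, a ≤ s ∧ b ≤ s ∧ ∀ t ∈ L, a ≤ t → b ≤ t → s ≤ t)
    (hinf : ∀ a ∈ L, ∀ b ∈ L, ∃ s ∈ L, s ≤ a ∧ s ≤ b ∧ ∀ t ∈ L, t ≤ a → t ≤ b → t ≤ s) :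
    (Set.InjOn betaMap L ∧
      ∀ a ∈ L, ∀ b ∈ L, (a ≤ b ↔ SlantedLe (betaMap a) (betaMap b))) ∧
    (∀ p' ∈ betaMap '' L, ∀ q' ∈ betaMap '' L,
      SlantedLt p' q' → (∀ r ∈ betaMap '' L, ¬(SlantedLt p' r ∧ SlantedLt r q')) →
        (p'.2 < q'.2 ∧
          ∀ r ∈ betaMap '' L, r ∈ segment ℝ p' q' → r = p' ∨ r = q')) ∧
    (∀ p₁ q₁ p₂ q₂ : ℝ × ℝ,
      p₁ ∈ betaMap '' L → q₁ ∈ betaMap '' L → p₂ ∈ betaMap '' L → q₂ ∈ betaMap '' L →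
      SlantedLt p₁ q₁ → (∀ r ∈ betaMap '' L, ¬(SlantedLt p₁ r ∧ SlantedLt r q₁)) →
      SlantedLt p₂ q₂ → (∀ r ∈ betaMap '' L, ¬(SlantedLt p₂ r ∧ SlantedLt r q₂)) →
      (p₁, q₁) ≠ (p₂, q₂) →
      segment ℝ p₁ q₁ ∩ segment ℝ p₂ q₂ ⊆ ({p₁, q₁} ∩ {p₂, q₂} : Set (ℝ × ℝ))) := by
  refine ⟨⟨betaMap_inj.injOn, ?_⟩, ?_, ?_⟩
  · intro a _ b _
    rw [SlantedLe, slantedLt_beta, betaMap_inj.eq_iff, le_iff_eq_or_lt]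
  · rintro _ ⟨p, hp, rfl⟩ _ ⟨q, hq, rfl⟩ hlt hcov
    rw [slantedLt_beta] at hlt
    refine ⟨?_, ?_⟩
    · simp only [betaMap]
      rcases Prod.lt_iff.1 hlt with ⟨h1, h2⟩ | ⟨h1, h2⟩ <;> linarith
    · rintro _ ⟨r, hr, rfl⟩ hseg
      rw [segment_beta, betaMap_inj.mem_set_image] at hseg
      rw [betaMap_inj.eq_iff, betaMap_inj.eq_iff]
      obtain ⟨h1, h2⟩ := mem_seg_bounds hlt.le hseg
      exact cover_beta hcov r hr h1 h2
  · rintro _ _ _ _ ⟨p₁, hp₁, rfl⟩ ⟨q₁, hq₁, rfl⟩ ⟨p₂, hp₂, rfl⟩ ⟨q₂, hq₂, rfl⟩ h₁ c₁ h₂ c₂ hne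
    rw [slantedLt_beta] at h₁ h₂
    rw [segment_beta, segment_beta]
    rintro _ ⟨⟨z, z₁, rfl⟩, hz⟩
    rw [betaMap_inj.mem_set_image] at hz
    have := core_planar L hsup hp₁ hq₁ hp₂ hq₂ h₁ (cover_beta c₁) h₂ (cover_beta c₂)
      (by rintro ⟨rfl, rfl⟩; exact hne rfl) z₁ hz
    simpa [betaMap_inj.eq_iff] using this
end

section
/- Let L be a finite subset of ℝ² equipped with the order induced from the slanted order of ℝ², and suppose that L with this order is a lattice in its own right. Then L is a planar lattice diagram: for every covering pair p ⋖ q of L, the second coordinate of p is strictly less than that of q; the closed segment from p to q meets L only in p and q; and for any two distinct covering pairs p ⋖ q and p' ⋖ q', the intersection of the closed segment from p to q with the closed segment from p' to q' is contained in {p, q} ∩ {p', q'}. -/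
lemma slantedLe_iff (p q : ℝ × ℝ) :
    SlantedLe p q ↔ q.1 - p.1 ≤ q.2 - p.2 ∧ p.1 - q.1 ≤ q.2 - p.2 := by
  unfold SlantedLe SlantedLt
  constructor
  · rintro (rfl | ⟨_, h⟩)
    · simp
    · have := abs_le.mp h
      constructor <;> linarith
  · rintro ⟨h1, h2⟩
    by_cases h : p = q
    · exact Or.inl h
    · exact Or.inr ⟨h, abs_le.mpr ⟨by linarith, h1⟩⟩

lemma slantedLe_trans {p q r : ℝ × ℝ} (h : SlantedLe p q) (h' : SlantedLe q r) :
    SlantedLe p r := by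
  rw [slantedLe_iff] at *
  constructor <;> linarith [h.1, h.2, h'.1, h'.2]

lemma slantedLe_antisymm {p q : ℝ × ℝ} (h : SlantedLe p q) (h' : SlantedLe q p) : p = q := by
  rw [slantedLe_iff] at *
  ext <;> linarith [h.1, h.2, h'.1, h'.2]

lemma slantedLe_of_segment {p q z : ℝ × ℝ} (h : SlantedLe p q) (hz : z ∈ segment ℝ p q) :
    SlantedLe p z ∧ SlantedLe z q := by
  obtain ⟨a, b, ha, hb, hab, rfl⟩ := hz
  simp only [slantedLe_iff] at *
  obtain ⟨h1, h2⟩ := h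
  obtain rfl : a = 1 - b := by linarith
  simp only [Prod.fst_add, Prod.snd_add, Prod.smul_fst, Prod.smul_snd, smul_eq_mul]
  refine ⟨⟨?_, ?_⟩, ?_, ?_⟩ <;> nlinarith

lemma eq_of_between {L : Set (ℝ × ℝ)} {p q s : ℝ × ℝ} (hs : s ∈ L)
    (hc : ∀ r ∈ L, ¬(SlantedLt p r ∧ SlantedLt r q))
    (h1 : SlantedLe p s) (h2 : SlantedLe s q) : s = p ∨ s = q := by
  rcases h1 with h1 | h1
  · exact Or.inl h1.symm
  · rcases h2 with h2 | h2
    · exact Or.inr h2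
    · exact (hc s hs ⟨h1, h2⟩).elim

lemma segment_ray {p q q' z : ℝ × ℝ} (hz : z ∈ segment ℝ p q) (hz' : z ∈ segment ℝ p q')
    (hne : z ≠ p) : q ∈ segment ℝ p q' ∨ q' ∈ segment ℝ p q := by
  rw [segment_eq_image'] at hz hz'
  obtain ⟨a, ⟨ha, ha1⟩, rfl⟩ := hz
  obtain ⟨b, ⟨hb, hb1⟩, h⟩ := hz'
  have key : ∀ (a b : ℝ) (q q' : ℝ × ℝ), 0 ≤ a → a ≤ b → 0 < b →
      p + b • (q' - p) = p + a • (q - p) → q' ∈ segment ℝ p q := by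
    intro a b q q' ha hab hb h
    rw [segment_eq_image']
    refine ⟨a / b, ⟨by positivity, (div_le_one hb).mpr hab⟩, ?_⟩
    have h' := add_left_cancel h
    have : (a / b) • (q - p) = q' - p := by
      rw [div_eq_inv_mul, mul_smul, ← h', smul_smul, inv_mul_cancel₀ hb.ne', one_smul]
    simp only [this]
    abel
  have ha0 : 0 < a := lt_of_le_of_ne ha (by rintro rfl; simp at hne)
  have hb0 : 0 < b := lt_of_le_of_ne hb (by rintro rfl; apply hne; rw [← h]; simp)
  rcases le_total a b with hab | hab
  · exact Or.inr (key a b q q' ha hab hb0 h)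
  · exact Or.inl (key b a q' q hb hab ha0 h.symm)

/-- Let `L` be a finite subset of `ℝ²` with the order induced from the slanted order, which
is a lattice in its own right (every two elements of `L` have a least upper bound and a
greatest lower bound within `L`).  Then `L` is a planar lattice diagram: coverings are
`y`-isotone, covering segments meet `L` only at their endpoints, and distinct covering
segments intersect only in common endpoints. -/
theorem slanted_lattice_is_planar_diagram (L : Set (ℝ × ℝ)) (hfin : L.Finite)
    (hsup : ∀ a ∈ L, ∀ b ∈ L, ∃ s ∈ L, SlantedLe a s ∧ SlantedLe b s ∧
      ∀ t ∈ L, SlantedLe a t → SlantedLe b t → SlantedLe s t)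
    (hinf : ∀ a ∈ L, ∀ b ∈ L, ∃ s ∈ L, SlantedLe s a ∧ SlantedLe s b ∧
      ∀ t ∈ L, SlantedLe t a → SlantedLe t b → SlantedLe t s) :
    (∀ p ∈ L, ∀ q ∈ L,
      SlantedLt p q → (∀ r ∈ L, ¬(SlantedLt p r ∧ SlantedLt r q)) →
        (p.2 < q.2 ∧ ∀ r ∈ L, r ∈ segment ℝ p q → r = p ∨ r = q)) ∧
    (∀ p q p' q' : ℝ × ℝ, p ∈ L → q ∈ L → p' ∈ L → q' ∈ L →
      SlantedLt p q → (∀ r ∈ L, ¬(SlantedLt p r ∧ SlantedLt r q)) →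
      SlantedLt p' q' → (∀ r ∈ L, ¬(SlantedLt p' r ∧ SlantedLt r q')) →
      (p, q) ≠ (p', q') →
      segment ℝ p q ∩ segment ℝ p' q' ⊆ ({p, q} ∩ {p', q'} : Set (ℝ × ℝ))) := by
  have hseg : ∀ p q r : ℝ × ℝ, r ∈ L → SlantedLt p q →
      (∀ r ∈ L, ¬(SlantedLt p r ∧ SlantedLt r q)) → r ∈ segment ℝ p q → r = p ∨ r = q := by
    intro p q r hr hpq hc hrs
    obtain ⟨h1, h2⟩ := slantedLe_of_segment (Or.inr hpq) hrs
    exact eq_of_between hr hc h1 h2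
  refine ⟨?_, ?_⟩
  · intro p hp q hq hpq hc
    refine ⟨?_, fun r hr hrs => hseg p q r hr hpq hc hrs⟩
    by_contra hlt
    have h1 := (slantedLe_iff p q).1 (Or.inr hpq)
    apply hpq.1
    ext <;> linarith [h1.1, h1.2]
  · rintro p q p' q' hp hq hp' hq' hpq hc hpq' hc' hne z ⟨hz, hz'⟩
    obtain ⟨a1, a2⟩ := slantedLe_of_segment (Or.inr hpq) hz
    obtain ⟨b1, b2⟩ := slantedLe_of_segment (Or.inr hpq') hz'
    obtain ⟨s, hs, s1, s2, s3⟩ := hsup p hp p' hp'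
    have c := eq_of_between hs hc s1 (s3 q hq (Or.inr hpq) (slantedLe_trans b1 a2))
    have c' := eq_of_between hs hc' s2 (s3 q' hq' (slantedLe_trans a1 b2) (Or.inr hpq'))
    rcases c with rfl | rfl <;> rcases c' with rfl | rfl
    · by_cases hzs : z = s
      · subst hzs; simp
      · exfalso
        apply hne
        rcases segment_ray hz hz' hzs with h | h
        · rcases hseg _ _ _ hq hpq' hc' h with h | h
          · exact (hpq.1 h.symm).elim
          · rw [h]
        · rcases hseg _ _ _ hq' hpq hc h with h | h
          · exact (hpq'.1 h.symm).elim
          · rw [h]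
    · obtain rfl := slantedLe_antisymm a1 b2
      simp
    · obtain rfl := slantedLe_antisymm b1 a2
      simp
    · by_cases hzs : z = s
      · subst hzs; simp
      · exfalso
        apply hne
        rw [segment_symm] at hz hz'
        rcases segment_ray hz hz' hzs with h | h <;> rw [segment_symm] at h
        · rcases hseg _ _ _ hp hpq' hc' h with h | h
          · rw [h]
          · exact (hpq.1 h).elim
        · rcases hseg _ _ _ hp' hpq hc h with h | h
          · rw [h]
          · exact (hpq'.1 h).elim
end

section
/- Let L be a finite lattice and let λ be a strict order on L complementary to the lattice order <. For p ∈ L define Canon(p) ∈ ℤ × ℤ by Canon(p) = (|{q ∈ L : λ q p}| − |{q ∈ L : λ p q}|, |{q ∈ L : q < p}| − |{q ∈ L : p < q}|). Then for all p, q ∈ L: (a) p < q if and only if Canon(p) <ₛ Canon(q) in the slanted order; (b) λ p q if and only if Canon(p) ⪡ₛ Canon(q) in the complementary slanted order. In particular, Canon is injective. -/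
/-- The slanted strict order on `ℤ × ℤ`. -/
def SlantedLtZ (p q : ℤ × ℤ) : Prop := p ≠ q ∧ |q.1 - p.1| ≤ q.2 - p.2

/-- The complementary slanted strict order on `ℤ × ℤ`. -/
def CSlantedLtZ (p q : ℤ × ℤ) : Prop := p ≠ q ∧ |q.2 - p.2| < q.1 - p.1

/-- The canonical map of a lattice with a specified complementary relation, built from
imbalances. -/
noncomputable def Canon {L : Type*} [Lattice L] (lam : L → L → Prop) (p : L) : ℤ × ℤ :=
  ((Nat.card {q : L // lam q p} : ℤ) - (Nat.card {q : L // lam p q} : ℤ),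
   (Nat.card {q : L // q < p} : ℤ) - (Nat.card {q : L // p < q} : ℤ))

/-- The union of `<` and a complementary order is a linear order, and the sum of the two
imbalances is strictly monotone for it. -/
theorem canon_sum_lt {L : Type*} [Lattice L] [Finite L] (lam : L → L → Prop)
    (h₁ : IsStrictOrderRel lam) (h₂ : ComplementaryTo (· < · : L → L → Prop) lam)
    (p q : L) (h : p < q ∨ lam p q) :
    (Canon lam p).1 + (Canon lam p).2 < (Canon lam q).1 + (Canon lam q).2 := by
  classical
  obtain ⟨hi, ht⟩ := h₁
  have hx : ∀ a b : L, lam a b → ¬ a < b ∧ ¬ b < a := by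
    intro a b hab
    have hne : a ≠ b := by
      rintro rfl
      exact hi _ hab
    rcases h₂ a b hne with h | h <;> tauto
  have htot : ∀ a b : L, a ≠ b → a < b ∨ b < a ∨ lam a b ∨ lam b a := by
    intro a b hne
    rcases h₂ a b hne with h | h <;> tauto
  have htr : ∀ a b c : L, (a < b ∨ lam a b) → (b < c ∨ lam b c) → (a < c ∨ lam a c) := by
    intro a b c hab hbc
    by_cases hac : a = c
    · subst hac
      rcases hab with hab | hab <;> rcases hbc with hbc | hbc
      · exact absurd (hab.trans hbc) (lt_irrefl _)
      · exact absurd hab (hx _ _ hbc).2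
      · exact absurd hbc (hx _ _ hab).2
      · exact absurd (ht _ _ _ hab hbc) (hi _)
    · rcases hab with hab | hab <;> rcases hbc with hbc | hbc
      · exact Or.inl (hab.trans hbc)
      · rcases htot a c hac with h | h | h | h
        · exact Or.inl h
        · exact absurd (h.trans hab) (hx _ _ hbc).2
        · exact Or.inr h
        · exact absurd hab (hx _ _ (ht _ _ _ hbc h)).2
      · rcases htot a c hac with h | h | h | h
        · exact Or.inl h
        · exact absurd (hbc.trans h) (hx _ _ hab).2
        · exact Or.inr h
        · exact absurd hbc (hx _ _ (ht _ _ _ h hab)).2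
      · exact Or.inr (ht _ _ _ hab hbc)
  have hirr : ∀ a : L, ¬ (a < a ∨ lam a a) := by
    intro a ha
    rcases ha with ha | ha
    · exact lt_irrefl _ ha
    · exact hi _ ha
  have hlow : ∀ a : L, Nat.card {x : L // lam x a} + Nat.card {x : L // x < a}
      = Set.ncard {x : L | x < a ∨ lam x a} := by
    intro a
    have hd : Disjoint {x : L | x < a} {x : L | lam x a} :=
      Set.disjoint_left.2 fun x hxa hl => (hx _ _ hl).1 hxa
    have := Set.ncard_union_eq hd (Set.toFinite _) (Set.toFinite _)
    rw [add_comm]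
    exact this.symm
  have hup : ∀ a : L, Nat.card {x : L // lam a x} + Nat.card {x : L // a < x}
      = Set.ncard {x : L | a < x ∨ lam a x} := by
    intro a
    have hd : Disjoint {x : L | a < x} {x : L | lam a x} :=
      Set.disjoint_left.2 fun x hxa hl => (hx _ _ hl).1 hxa
    have := Set.ncard_union_eq hd (Set.toFinite _) (Set.toFinite _)
    rw [add_comm]
    exact this.symm
  have c1 : Set.ncard {x : L | x < p ∨ lam x p} < Set.ncard {x : L | x < q ∨ lam x q} := by
    apply Set.ncard_lt_ncard _ (Set.toFinite _)
    exact ⟨fun x hxp => htr x p q hxp h, fun hs => hirr p (hs h)⟩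
  have c2 : Set.ncard {x : L | q < x ∨ lam q x} < Set.ncard {x : L | p < x ∨ lam p x} := by
    apply Set.ncard_lt_ncard _ (Set.toFinite _)
    exact ⟨fun x hxp => htr p q x h hxp, fun hs => hirr q (hs h)⟩
  have e1 := hlow p
  have e2 := hlow q
  have e3 := hup p
  have e4 := hup q
  simp only [Canon]
  omega

/-- For a finite lattice `L` with complementary order relation `lam`, the canonical map
reflects the lattice order as the slanted order, and `lam` as the complementary slanted
order; in particular it is injective. -/
theorem canon_is_canonical_form {L : Type*} [Lattice L] [Finite L] (lam : L → L → Prop)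
    (h₁ : IsStrictOrderRel lam) (h₂ : ComplementaryTo (· < · : L → L → Prop) lam) :
    (∀ p q : L, p < q ↔ SlantedLtZ (Canon lam p) (Canon lam q)) ∧
    (∀ p q : L, lam p q ↔ CSlantedLtZ (Canon lam p) (Canon lam q)) ∧
    Function.Injective (Canon lam) := by
  have s₁ : IsStrictOrderRel (fun a b => lam b a) :=
    ⟨h₁.1, fun a b c hab hbc => h₁.2 c b a hbc hab⟩
  have s₂ : ComplementaryTo (· < · : L → L → Prop) (fun a b => lam b a) := by
    intro a b hne
    have := h₂ a b hne
    rwa [or_comm (a := lam a b)] at this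
  have e : ∀ a : L, (Canon (fun a b => lam b a) a).1 = -(Canon lam a).1 ∧
      (Canon (fun a b => lam b a) a).2 = (Canon lam a).2 := by
    intro a
    simp [Canon]
  have A := canon_sum_lt lam h₁ h₂
  have B : ∀ p q : L, (p < q ∨ lam q p) →
      -(Canon lam p).1 + (Canon lam p).2 < -(Canon lam q).1 + (Canon lam q).2 := by
    intro p q h
    have := canon_sum_lt _ s₁ s₂ p q h
    rwa [(e p).1, (e p).2, (e q).1, (e q).2] at this
  have htot : ∀ a b : L, a = b ∨ a < b ∨ b < a ∨ lam a b ∨ lam b a := by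
    intro a b
    by_cases hne : a = b
    · exact Or.inl hne
    · rcases h₂ a b hne with h | h <;> tauto
  have F1 : ∀ p q : L, p < q →
      |(Canon lam q).1 - (Canon lam p).1| < (Canon lam q).2 - (Canon lam p).2 := by
    intro p q h
    have a := A p q (Or.inl h)
    have b := B p q (Or.inl h)
    rw [abs_lt]
    constructor <;> linarith
  have F2 : ∀ p q : L, lam p q →
      |(Canon lam q).2 - (Canon lam p).2| < (Canon lam q).1 - (Canon lam p).1 := by
    intro p q h
    have a := A p q (Or.inr h)
    have b := B q p (Or.inr h)
    rw [abs_lt]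
    constructor <;> linarith
  have inj : Function.Injective (Canon lam) := by
    intro p q hpq
    rcases htot p q with h | h | h | h | h
    · exact h
    · simpa [hpq] using F1 _ _ h
    · simpa [hpq] using F1 _ _ h
    · simpa [hpq] using F2 _ _ h
    · simpa [hpq] using F2 _ _ h
  refine ⟨fun p q => ⟨fun h => ⟨fun hc => h.ne (inj hc), (F1 p q h).le⟩, ?_⟩,
    fun p q => ⟨fun h => ⟨fun hc => ?_, F2 p q h⟩, ?_⟩, inj⟩
  · rintro ⟨hne, hle⟩
    rw [abs_le] at hle
    rcases htot p q with h | h | h | h | h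
    · exact absurd (congrArg _ h) hne
    · exact h
    · have := abs_lt.1 (F1 _ _ h); omega
    · have := abs_lt.1 (F2 _ _ h); omega
    · have := abs_lt.1 (F2 _ _ h); omega
  · have := inj hc
    subst this
    exact h₁.1 _ h
  · rintro ⟨hne, hle⟩
    rw [abs_lt] at hle
    rcases htot p q with h | h | h | h | h
    · exact absurd (congrArg _ h) hne
    · have := abs_lt.1 (F1 _ _ h); omega
    · have := abs_lt.1 (F1 _ _ h); omega
    · exact h
    · have := abs_lt.1 (F2 _ _ h); omega
end

section
/- Let L be a finite planar lattice and let K be a finite lattice admitting an order embedding into L (a map f : K → L with p ≤ q in K iff f p ≤ f q in L). Then K is a planar lattice. -/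
namespace PlanarAux

/-- A lattice with two real coordinates realizing its order is planar. -/
lemma planar_of_coords {K : Type*} [Lattice K] [Finite K] (u v : K → ℝ)
    (hu : ∀ a b, a < b → u a < u b) (hv : ∀ a b, a < b → v a < v b)
    (huv : ∀ a b, u a ≤ u b → v a ≤ v b → a ≤ b) : IsPlanarLattice K := by
  have key : ∀ p q : K, p ≤ q → ∀ z ∈ segment ℝ ((u p, v p) : ℝ × ℝ) (u q, v q),
      u p ≤ z.1 ∧ v p ≤ z.2 ∧ z.1 ≤ u q ∧ z.2 ≤ v q := by
    rintro p q hpq z ⟨s, t, hs, ht, hst, rfl⟩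
    have h1 : u p ≤ u q := by
      rcases hpq.eq_or_lt with h | h
      · rw [h]
      · exact (hu _ _ h).le
    have h2 : v p ≤ v q := by
      rcases hpq.eq_or_lt with h | h
      · rw [h]
      · exact (hv _ _ h).le
    obtain rfl : s = 1 - t := by linarith
    simp only [Prod.smul_mk, Prod.mk_add_mk, smul_eq_mul]
    refine ⟨?_, ?_, ?_, ?_⟩ <;> nlinarith
  have sq : ∀ p q r : K, p ⋖ q → p ≤ r → r ≤ q → r = p ∨ r = q := by
    intro p q r h h1 h2
    exact h.eq_or_eq h1 h2
  refine ⟨fun a => (u a, v a), ?_, ?_, ?_, ?_⟩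
  · intro a b h
    simp only [Prod.mk.injEq] at h
    exact le_antisymm (huv _ _ h.1.le h.2.le) (huv _ _ h.1.ge h.2.ge)
  · intro p q h
    exact hv _ _ h.lt
  · intro p q h r hr
    obtain ⟨h1, h2, h3, h4⟩ := key p q h.le _ hr
    rcases sq p q r h (huv _ _ h1 h2) (huv _ _ h3 h4) with rfl | rfl
    · exact Or.inl rfl
    · exact Or.inr rfl
  · rintro p q p' q' h h' hne z ⟨hz, hz'⟩
    obtain ⟨h1, h2, h3, h4⟩ := key p q h.le _ hz
    obtain ⟨k1, k2, k3, k4⟩ := key p' q' h'.le _ hz'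
    have hpq' : p ≤ q' := huv _ _ (h1.trans k3) (h2.trans k4)
    have hp'q : p' ≤ q := huv _ _ (k1.trans h3) (k2.trans h4)
    have e1 := sq p q (p ⊔ p') h le_sup_left (sup_le h.le hp'q)
    have e2 := sq p' q' (p ⊔ p') h' le_sup_right (sup_le hpq' h'.le)
    have fin : ∀ r : K, u r = z.1 → v r = z.2 → (r = p ∨ r = q) → (r = p' ∨ r = q') →
        z ∈ ({(u p, v p), (u q, v q)} ∩ {(u p', v p'), (u q', v q')} : Set (ℝ × ℝ)) := by
      intro r hr1 hr2 hr hr'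
      have hz : z = (u r, v r) := Prod.ext hr1.symm hr2.symm
      subst hz
      constructor
      · rcases hr with rfl | rfl <;> simp
      · rcases hr' with rfl | rfl <;> simp
    rcases e1 with e1 | e1 <;> rcases e2 with e2 | e2 <;> rw [e1] at e2
    · subst e2
      obtain ⟨s, t, hs, ht, hst, rfl⟩ := hz
      obtain ⟨s', t', hs', ht', hst', hz'⟩ := hz'
      obtain rfl : s = 1 - t := by linarith
      obtain rfl : s' = 1 - t' := by linarith
      simp only [Prod.smul_mk, Prod.mk_add_mk, smul_eq_mul, Prod.mk.injEq] at hz'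
      obtain ⟨z1, z2⟩ := hz'
      have uq := hu _ _ h.lt
      have vq := hv _ _ h.lt
      have uq' := hu _ _ h'.lt
      have vq' := hv _ _ h'.lt
      have w1 : t' * (u q' - u p) = t * (u q - u p) := by linarith
      have w2 : t' * (v q' - v p) = t * (v q - v p) := by linarith
      rcases ht.eq_or_lt with h0 | h0
      · subst h0
        refine fin p ?_ ?_ (Or.inl rfl) (Or.inl rfl) <;> simp
      · exfalso
        have ht0 : 0 < t' := by
          rcases ht'.eq_or_lt with h0' | h0'
          · subst h0'
            nlinarith
          · exact h0'
        have : q ≤ q' ∨ q' ≤ q := by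
          rcases le_total t t' with htt | htt
          · right
            apply huv
            · by_contra hc
              push Not at hc
              nlinarith
            · by_contra hc
              push Not at hc
              nlinarith
          · left
            apply huv
            · by_contra hc
              push Not at hc
              nlinarith
            · by_contra hc
              push Not at hc
              nlinarith
        apply hne
        rcases this with hh | hh
        · rcases sq _ _ _ h' h.le hh with e | e
          · exact absurd e h.lt.ne'
          · rw [e]
        · rcases sq _ _ _ h h'.le hh with e | e
          · exact absurd e h'.lt.ne'
          · rw [e]
    · subst e2
      exact fin p (le_antisymm h1 k3) (le_antisymm h2 k4) (Or.inl rfl) (Or.inr rfl)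
    · subst e2
      exact fin q (le_antisymm k1 h3) (le_antisymm k2 h4) (Or.inr rfl) (Or.inl rfl)
    · subst e2
      obtain ⟨s, t, hs, ht, hst, rfl⟩ := hz
      obtain ⟨s', t', hs', ht', hst', hz'⟩ := hz'
      obtain rfl : t = 1 - s := by linarith
      obtain rfl : t' = 1 - s' := by linarith
      simp only [Prod.smul_mk, Prod.mk_add_mk, smul_eq_mul, Prod.mk.injEq] at hz'
      obtain ⟨z1, z2⟩ := hz'
      have uq := hu _ _ h.lt
      have vq := hv _ _ h.lt
      have uq' := hu _ _ h'.lt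
      have vq' := hv _ _ h'.lt
      have w1 : s' * (u q - u p') = s * (u q - u p) := by linarith
      have w2 : s' * (v q - v p') = s * (v q - v p) := by linarith
      rcases hs.eq_or_lt with h0 | h0
      · subst h0
        refine fin q ?_ ?_ (Or.inr rfl) (Or.inr rfl) <;> simp
      · exfalso
        have ht0 : 0 < s' := by
          rcases hs'.eq_or_lt with h0' | h0'
          · subst h0'
            nlinarith
          · exact h0'
        have : p ≤ p' ∨ p' ≤ p := by
          rcases le_total s s' with htt | htt
          · left
            apply huv
            · by_contra hc
              push Not at hc
              nlinarith
            · by_contra hc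
              push Not at hc
              nlinarith
          · right
            apply huv
            · by_contra hc
              push Not at hc
              nlinarith
            · by_contra hc
              push Not at hc
              nlinarith
        apply hne
        rcases this with hh | hh
        · rcases sq _ _ _ h hh h'.le with e | e
          · rw [e]
          · exact absurd e h'.lt.ne
        · rcases sq _ _ _ h' hh h.le with e | e
          · rw [e]
          · exact absurd e h.lt.ne

/-- A planar diagram of a lattice. -/
structure Diag {L : Type*} [Lattice L] (f : L → ℝ × ℝ) : Prop where
  inj : Function.Injective f
  iso : ∀ p q : L, p ⋖ q → (f p).2 < (f q).2
  non : ∀ p q : L, p ⋖ q → ∀ r : L, f r ∈ segment ℝ (f p) (f q) → f r = f p ∨ f r = f q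
  pla : ∀ p q p' q' : L, p ⋖ q → p' ⋖ q' → (p, q) ≠ (p', q') →
      segment ℝ (f p) (f q) ∩ segment ℝ (f p') (f q') ⊆
        ({f p, f q} ∩ {f p', f q'} : Set (ℝ × ℝ))

lemma Diag.cross {L : Type*} [Lattice L] {f : L → ℝ × ℝ} (hd : Diag f) {p q p' q' : L}
    (h : p ⩿ q) (h' : p' ⩿ q') {z : ℝ × ℝ} (hz : z ∈ segment ℝ (f p) (f q))
    (hz' : z ∈ segment ℝ (f p') (f q')) : p ≤ q' := by
  rcases wcovBy_iff_covBy_or_eq.1 h with c | rfl <;>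
    rcases wcovBy_iff_covBy_or_eq.1 h' with c' | rfl
  · by_cases he : (p, q) = (p', q')
    · simp only [Prod.mk.injEq] at he
      rw [← he.2]
      exact h.le
    · obtain ⟨h1, h2⟩ := hd.pla p q p' q' c c' he ⟨hz, hz'⟩
      have h1 : p ≤ q ∧ (z = f p ∨ z = f q) := ⟨h.le, h1⟩
      have : ∃ r, z = f r ∧ p ≤ r := by
        rcases h1.2 with e | e
        · exact ⟨p, e, le_rfl⟩
        · exact ⟨q, e, h.le⟩
      obtain ⟨r, rfl, hr⟩ := this
      rcases h2 with e | e
      · exact hr.trans ((hd.inj e).le.trans h'.le)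
      · exact hr.trans (hd.inj e).le
  · rw [segment_same, Set.mem_singleton_iff] at hz'
    subst hz'
    rcases hd.non p q c _ hz with e | e
    · exact (hd.inj e).ge
    · exact h.le.trans (hd.inj e).ge
  · rw [segment_same, Set.mem_singleton_iff] at hz
    subst hz
    rcases hd.non p' q' c' _ hz' with e | e
    · exact (hd.inj e).le.trans h'.le
    · exact (hd.inj e).le
  · rw [segment_same, Set.mem_singleton_iff] at hz hz'
    subst hz
    exact (hd.inj hz').le

/-- `E` is a curve drawn along a chain from `a` to `b`. -/
structure Curve {L : Type*} [Lattice L] (f : L → ℝ × ℝ) (a b : L) (E : ℝ → ℝ) : Prop where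
  cont : Continuous E
  le : (f a).2 ≤ (f b).2
  left : E (f a).2 = (f a).1
  right : E (f b).2 = (f b).1
  edge : ∀ t, (f a).2 ≤ t → t ≤ (f b).2 →
    ∃ p q, p ⩿ q ∧ a ≤ p ∧ q ≤ b ∧ (E t, t) ∈ segment ℝ (f p) (f q)

lemma Curve.glue {L : Type*} [Lattice L] {f : L → ℝ × ℝ} {a b c : L} (hab : a ≤ b) (hbc : b ≤ c)
    {E F : ℝ → ℝ} (hE : Curve f a b E) (hF : Curve f b c F) :
    ∃ G, Curve f a c G ∧ (∀ t ≤ (f b).2, G t = E t) ∧ (∀ t, (f b).2 ≤ t → G t = F t) := by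
  have g1 : ∀ t ≤ (f b).2, (if t ≤ (f b).2 then E t else F t) = E t := fun t ht => if_pos ht
  have g2 : ∀ t, (f b).2 ≤ t → (if t ≤ (f b).2 then E t else F t) = F t := by
    intro t ht
    rcases ht.eq_or_lt with h | h
    · subst h
      rw [if_pos le_rfl, hE.right, hF.left]
    · exact if_neg h.not_ge
  refine ⟨fun t => if t ≤ (f b).2 then E t else F t, ⟨?_, hE.le.trans hF.le, ?_, ?_, ?_⟩, g1, g2⟩
  · refine Continuous.if_le hE.cont hF.cont continuous_id continuous_const ?_
    intro t ht
    subst ht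
    rw [hE.right, hF.left]
  · exact (g1 _ hE.le).trans hE.left
  · exact (g2 _ hF.le).trans hF.right
  · intro t h1 h2
    rcases le_total t (f b).2 with h | h
    · obtain ⟨p, q, x1, x2, x3, x4⟩ := hE.edge t h1 h
      rw [g1 t h]
      exact ⟨p, q, x1, x2, x3.trans hbc, x4⟩
    · obtain ⟨p, q, x1, x2, x3, x4⟩ := hF.edge t h h2
      rw [g2 t h]
      exact ⟨p, q, x1, hab.trans x2, x3, x4⟩

lemma Diag.curve {L : Type*} [Lattice L] [Finite L] {f : L → ℝ × ℝ} (hd : Diag f) {a b : L}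
    (hab : a ≤ b) : ∃ E, Curve f a b E := by
  classical
  have := Fintype.ofFinite L
  let _ : LocallyFiniteOrder L := Fintype.toLocallyFiniteOrder
  have h := le_iff_reflTransGen_covBy.1 hab
  clear hab
  induction h with
  | refl =>
    refine ⟨fun _ => (f a).1, continuous_const, le_rfl, rfl, rfl, ?_⟩
    intro t h1 h2
    obtain rfl := le_antisymm h1 h2
    exact ⟨a, a, WCovBy.rfl, le_rfl, le_rfl, by simp⟩
  | @tail b c h1 h2 ih =>
    obtain ⟨E, hE⟩ := ih
    have hlt := hd.iso b c h2
    have hne : (f c).2 - (f b).2 ≠ 0 := by linarith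
    have hF : Curve f b c (fun t => (f b).1 +
        (t - (f b).2) / ((f c).2 - (f b).2) * ((f c).1 - (f b).1)) := by
      refine ⟨by fun_prop, hlt.le, by simp, by simp [div_self hne], ?_⟩
      intro t ht1 ht2
      refine ⟨b, c, h2.wcovBy, le_rfl, le_rfl, ?_⟩
      rw [segment_eq_image']
      refine ⟨(t - (f b).2) / ((f c).2 - (f b).2), ⟨?_, ?_⟩, ?_⟩
      · exact div_nonneg (by linarith) (by linarith)
      · rw [div_le_one (by linarith)]
        linarith
      · ext
        · simp
        · simp [div_mul_cancel₀ _ hne]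
    obtain ⟨G, hG, -⟩ := hE.glue (le_iff_reflTransGen_covBy.2 h1) h2.le hF
    exact ⟨G, hG⟩

/-- `E` is a curve from bottom to top drawn along a chain through `a`. -/
structure Thru {L : Type*} [Lattice L] (f : L → ℝ × ℝ) (o i a : L) (E : ℝ → ℝ) : Prop where
  cont : Continuous E
  val : E (f a).2 = (f a).1
  up : ∀ t, (f a).2 ≤ t → t ≤ (f i).2 →
    ∃ p q, p ⩿ q ∧ a ≤ p ∧ (E t, t) ∈ segment ℝ (f p) (f q)
  down : ∀ t, (f o).2 ≤ t → t ≤ (f a).2 →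
    ∃ p q, p ⩿ q ∧ q ≤ a ∧ (E t, t) ∈ segment ℝ (f p) (f q)

lemma Thru.mk' {L : Type*} [Lattice L] {f : L → ℝ × ℝ} {o i a : L}
    {E F : ℝ → ℝ} (hE : Curve f o a E) (hF : Curve f a i F) (G : ℝ → ℝ) (hG : Continuous G)
    (h1 : ∀ t ≤ (f a).2, (f o).2 ≤ t → G t = E t)
    (h2 : ∀ t, (f a).2 ≤ t → t ≤ (f i).2 → G t = F t) : Thru f o i a G := by
  refine ⟨hG, (h1 _ le_rfl hE.le).trans hE.right, ?_, ?_⟩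
  · intro t ht1 ht2
    obtain ⟨p, q, x1, x2, x3, x4⟩ := hF.edge t ht1 ht2
    exact ⟨p, q, x1, x2, by rwa [h2 t ht1 ht2]⟩
  · intro t ht1 ht2
    obtain ⟨p, q, x1, x2, x3, x4⟩ := hE.edge t ht1 ht2
    exact ⟨p, q, x1, x3, by rwa [h1 t ht2 ht1]⟩

lemma Diag.thru {L : Type*} [Lattice L] [Finite L] {f : L → ℝ × ℝ} (hd : Diag f) {o i : L}
    (ho : ∀ a, o ≤ a) (hi : ∀ a, a ≤ i) {a b : L} (hab : a ≤ b) :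
    ∃ E, Thru f o i a E ∧ Thru f o i b E := by
  obtain ⟨E, hE⟩ := hd.curve (ho a)
  obtain ⟨F, hF⟩ := hd.curve hab
  obtain ⟨G, hG⟩ := hd.curve (hi b)
  obtain ⟨EF, hEF, e1, e2⟩ := hE.glue (ho a) hab hF
  obtain ⟨FG, hFG, e3, e4⟩ := hF.glue hab (hi b) hG
  obtain ⟨H, hH, e5, e6⟩ := hEF.glue (ho b) (hi b) hG
  refine ⟨H, Thru.mk' hE hFG H hH.cont ?_ ?_,
    Thru.mk' hEF hG H hH.cont (fun t h _ => e5 t h) (fun t h _ => e6 t h)⟩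
  · intro t h _
    rw [e5 t (h.trans hF.le), e1 t h]
  · intro t h _
    rcases le_total t (f b).2 with h' | h'
    · rw [e5 t h', e2 t h, e3 t h']
    · rw [e6 t h', e4 t h']

lemma Diag.mono {L : Type*} [Lattice L] [Finite L] {f : L → ℝ × ℝ} (hd : Diag f) {a b : L}
    (hab : a ≤ b) : (f a).2 ≤ (f b).2 := (hd.curve hab).choose_spec.le

lemma Diag.ne {L : Type*} [Lattice L] [Finite L] {f : L → ℝ × ℝ} (hd : Diag f) {o i : L}
    (ho : ∀ a, o ≤ a) (hi : ∀ a, a ≤ i) {a b : L} (hab : ¬ a ≤ b)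
    {A B : ℝ → ℝ} (hA : Thru f o i a A) (hB : Thru f o i b B) {t : ℝ} (h1 : (f a).2 ≤ t)
    (h2 : t ≤ (f b).2) : A t ≠ B t := by
  intro he
  obtain ⟨p, q, x1, x2, x3⟩ := hA.up t h1 (h2.trans (hd.mono (hi b)))
  obtain ⟨p', q', y1, y2, y3⟩ := hB.down t ((hd.mono (ho a)).trans h1) h2
  rw [← he] at y3
  exact hab (x2.trans ((hd.cross x1 y1 x3 y3).trans y2))

lemma Diag.sign {L : Type*} [Lattice L] [Finite L] {f : L → ℝ × ℝ} (hd : Diag f) {o i : L}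
    (ho : ∀ a, o ≤ a) (hi : ∀ a, a ≤ i) {a b : L} (hab : ¬ a ≤ b) (hba : ¬ b ≤ a)
    {A B : ℝ → ℝ} (hA : Thru f o i a A) (hB : Thru f o i b B) {s t : ℝ}
    (hs : s ∈ Set.uIcc (f a).2 (f b).2) (ht : t ∈ Set.uIcc (f a).2 (f b).2) (h : A s < B s) :
    A t < B t := by
  by_contra hc
  push Not at hc
  have := intermediate_value_uIcc (f := fun r => A r - B r) (a := s) (b := t)
    ((hA.cont.sub hB.cont).continuousOn)
  have h0 : (0 : ℝ) ∈ Set.uIcc (A s - B s) (A t - B t) := by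
    rw [Set.mem_uIcc]
    left
    constructor <;> linarith
  obtain ⟨r, hr, hr0⟩ := this h0
  have hr' : r ∈ Set.uIcc (f a).2 (f b).2 := Set.uIcc_subset_uIcc hs ht hr
  have he : A r = B r := by
    simp only at hr0
    linarith
  rw [Set.mem_uIcc] at hr'
  rcases hr' with ⟨h1, h2⟩ | ⟨h1, h2⟩
  · exact hd.ne ho hi hab hA hB h1 h2 he
  · exact hd.ne ho hi hba hB hA h1 h2 he.symm

/-- `a` is incomparable to `b` and to the left of it. -/
def Lft {L : Type*} [Lattice L] (f : L → ℝ × ℝ) (o i a b : L) : Prop :=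
  ¬ a ≤ b ∧ ¬ b ≤ a ∧ ∀ A B, Thru f o i a A → Thru f o i b B →
    ∀ t ∈ Set.uIcc (f a).2 (f b).2, A t < B t

lemma Diag.lft_of {L : Type*} [Lattice L] [Finite L] {f : L → ℝ × ℝ} (hd : Diag f) {o i : L}
    (ho : ∀ a, o ≤ a) (hi : ∀ a, a ≤ i) {a b : L} (hab : ¬ a ≤ b) (hba : ¬ b ≤ a)
    {A B : ℝ → ℝ} (hA : Thru f o i a A) (hB : Thru f o i b B) {s : ℝ}
    (hs : s ∈ Set.uIcc (f a).2 (f b).2) (h : A s < B s) : Lft f o i a b := by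
  refine ⟨hab, hba, ?_⟩
  intro A' B' hA' hB' t ht
  have ha : (f a).2 ∈ Set.uIcc (f a).2 (f b).2 := Set.left_mem_uIcc
  have hb : (f b).2 ∈ Set.uIcc (f a).2 (f b).2 := Set.right_mem_uIcc
  have h1 := hd.sign ho hi hab hba hA hB hs ha h
  rw [hA.val, ← hA'.val] at h1
  have h2 := hd.sign ho hi hab hba hA' hB ha hb h1
  rw [hB.val, ← hB'.val] at h2
  exact hd.sign ho hi hab hba hA' hB' hb ht h2

lemma Diag.total {L : Type*} [Lattice L] [Finite L] {f : L → ℝ × ℝ} (hd : Diag f) {o i : L}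
    (ho : ∀ a, o ≤ a) (hi : ∀ a, a ≤ i) {a b : L} (hab : ¬ a ≤ b) (hba : ¬ b ≤ a) :
    Lft f o i a b ∨ Lft f o i b a := by
  obtain ⟨A, hA, -⟩ := hd.thru ho hi (le_refl a)
  obtain ⟨B, hB, -⟩ := hd.thru ho hi (le_refl b)
  have hne : A (f a).2 ≠ B (f a).2 := by
    rcases le_total (f a).2 (f b).2 with h | h
    · exact hd.ne ho hi hab hA hB le_rfl h
    · exact (hd.ne ho hi hba hB hA h le_rfl).symm
  rcases lt_or_gt_of_ne hne with h | h
  · exact Or.inl (hd.lft_of ho hi hab hba hA hB Set.left_mem_uIcc h)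
  · exact Or.inr (hd.lft_of ho hi hba hab hB hA Set.right_mem_uIcc h)

lemma Diag.asymm {L : Type*} [Lattice L] [Finite L] {f : L → ℝ × ℝ} (hd : Diag f) {o i : L}
    (ho : ∀ a, o ≤ a) (hi : ∀ a, a ≤ i) {a b : L} (h : Lft f o i a b) (h' : Lft f o i b a) :
    False := by
  obtain ⟨A, hA, -⟩ := hd.thru ho hi (le_refl a)
  obtain ⟨B, hB, -⟩ := hd.thru ho hi (le_refl b)
  exact lt_asymm (h.2.2 A B hA hB _ Set.left_mem_uIcc) (h'.2.2 B A hB hA _ Set.right_mem_uIcc)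

/-- No element lies between two comparable ones. -/
lemma Diag.between {L : Type*} [Lattice L] [Finite L] {f : L → ℝ × ℝ} (hd : Diag f) {o i : L}
    (ho : ∀ a, o ≤ a) (hi : ∀ a, a ≤ i) {a b c : L} (hab : a ≤ b ∨ b ≤ a) (h : Lft f o i a c)
    (h' : Lft f o i c b) : False := by
  have : ∃ E, Thru f o i a E ∧ Thru f o i b E := by
    rcases hab with hab | hab
    · exact hd.thru ho hi hab
    · obtain ⟨E, h1, h2⟩ := hd.thru ho hi hab
      exact ⟨E, h2, h1⟩
  obtain ⟨E, h1, h2⟩ := this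
  obtain ⟨C, hC, -⟩ := hd.thru ho hi (le_refl c)
  exact lt_asymm (h.2.2 E C h1 hC _ Set.right_mem_uIcc) (h'.2.2 C E hC h2 _ Set.left_mem_uIcc)

lemma Diag.cyc {L : Type*} [Lattice L] [Finite L] {f : L → ℝ × ℝ} (hd : Diag f) {o i : L}
    (ho : ∀ a, o ≤ a) (hi : ∀ a, a ≤ i) {a b c : L} (h1 : Lft f o i a b)
    (h2 : Lft f o i b c) (h3 : Lft f o i c a) (hm : (f b).2 ∈ Set.uIcc (f c).2 (f a).2) :
    False := by
  obtain ⟨A, hA, -⟩ := hd.thru ho hi (le_refl a)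
  obtain ⟨B, hB, -⟩ := hd.thru ho hi (le_refl b)
  obtain ⟨C, hC, -⟩ := hd.thru ho hi (le_refl c)
  have e1 := h1.2.2 A B hA hB _ Set.right_mem_uIcc
  have e2 := h2.2.2 B C hB hC _ Set.left_mem_uIcc
  have e3 := h3.2.2 C A hC hA _ hm
  linarith

lemma Diag.trans {L : Type*} [Lattice L] [Finite L] {f : L → ℝ × ℝ} (hd : Diag f) {o i : L}
    (ho : ∀ a, o ≤ a) (hi : ∀ a, a ≤ i) {a b c : L} (h1 : Lft f o i a b)
    (h2 : Lft f o i b c) : Lft f o i a c := by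
  by_cases hac : a ≤ c
  · exact (hd.between ho hi (Or.inl hac) h1 h2).elim
  by_cases hca : c ≤ a
  · exact (hd.between ho hi (Or.inr hca) h1 h2).elim
  rcases hd.total ho hi hac hca with h | h3
  · exact h
  exfalso
  have : (f b).2 ∈ Set.uIcc (f c).2 (f a).2 ∨ (f c).2 ∈ Set.uIcc (f a).2 (f b).2 ∨
      (f a).2 ∈ Set.uIcc (f b).2 (f c).2 := by
    simp only [Set.mem_uIcc]
    grind
  rcases this with h | h | h
  · exact hd.cyc ho hi h1 h2 h3 h
  · exact hd.cyc ho hi h2 h3 h1 h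
  · exact hd.cyc ho hi h3 h1 h2 h

/-- Abstract linear extension from a conjugate order. -/
lemma exists_ext {L : Type*} [PartialOrder L] [Finite L] (R : L → L → Prop)
    (hinc : ∀ a b, R a b → ¬ a ≤ b ∧ ¬ b ≤ a)
    (htot : ∀ a b, ¬ a ≤ b → ¬ b ≤ a → R a b ∨ R b a)
    (hasymm : ∀ a b, R a b → R b a → False)
    (htrans : ∀ a b c, R a b → R b c → R a c) :
    ∃ u : L → ℝ, (∀ a b, a < b → u a < u b) ∧ (∀ a b, R a b → u a < u b) := by
  have key : ∀ a b c, (a < b ∨ R a b) → (b < c ∨ R b c) → (a < c ∨ R a c) := by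
    intro a b c h1 h2
    by_cases hac : a ≤ c
    · rcases hac.eq_or_lt with rfl | h
      · exfalso
        rcases h1 with h1 | h1 <;> rcases h2 with h2 | h2
        · exact lt_asymm h1 h2
        · exact (hinc _ _ h2).2 h1.le
        · exact (hinc _ _ h1).2 h2.le
        · exact hasymm _ _ h1 h2
      · exact Or.inl h
    by_cases hca : c ≤ a
    · exfalso
      rcases h1 with h1 | h1 <;> rcases h2 with h2 | h2
      · exact hac (h1.trans h2).le
      · exact (hinc _ _ h2).2 (hca.trans h1.le)
      · exact (hinc _ _ h1).2 (h2.le.trans hca)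
      · exact (hinc _ _ (htrans _ _ _ h1 h2)).2 hca
    rcases htot a c hac hca with h | h
    · exact Or.inr h
    exfalso
    rcases h1 with h1 | h1 <;> rcases h2 with h2 | h2
    · exact hac (h1.trans h2).le
    · exact (hinc _ _ (htrans _ _ _ h2 h)).2 h1.le
    · exact (hinc _ _ (htrans _ _ _ h h1)).2 h2.le
    · exact hasymm _ _ (htrans _ _ _ h1 h2) h
  have mono : ∀ a b, (a < b ∨ R a b) →
      ((Set.ncard {c | c < a ∨ R c a} : ℕ) : ℝ) < ((Set.ncard {c | c < b ∨ R c b} : ℕ) : ℝ) := by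
    intro a b h
    rw [Nat.cast_lt]
    apply Set.ncard_lt_ncard _ (Set.toFinite _)
    refine ⟨fun c hc => key c a b hc h, fun hs => ?_⟩
    rcases hs (show a ∈ {c | c < b ∨ R c b} from h) with h | h
    · exact lt_irrefl _ h
    · exact hasymm _ _ h h
  exact ⟨fun a => ((Set.ncard {c | c < a ∨ R c a} : ℕ) : ℝ),
    fun a b h => mono a b (Or.inl h), fun a b h => mono a b (Or.inr h)⟩

lemma coords_of_planar {L : Type*} [Lattice L] [Finite L] [Nonempty L] (hL : IsPlanarLattice L) :
    ∃ u v : L → ℝ, (∀ a b, a < b → u a < u b) ∧ (∀ a b, a < b → v a < v b) ∧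
      (∀ a b, u a ≤ u b → v a ≤ v b → a ≤ b) := by
  obtain ⟨f, h1, h2, h3, h4⟩ := hL
  have hd : Diag f := ⟨h1, h2, h3, h4⟩
  obtain ⟨o, ho⟩ : ∃ o : L, ∀ a, o ≤ a := by
    obtain ⟨m, hm⟩ := (Set.toFinite (Set.univ : Set L)).exists_minimal Set.univ_nonempty
    exact ⟨m, fun a => (hm.2 (Set.mem_univ _) (inf_le_left : m ⊓ a ≤ m)).trans inf_le_right⟩
  obtain ⟨i, hi⟩ : ∃ i : L, ∀ a, a ≤ i := by
    obtain ⟨m, hm⟩ := (Set.toFinite (Set.univ : Set L)).exists_maximal Set.univ_nonempty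
    exact ⟨m, fun a => le_sup_right.trans (hm.2 (Set.mem_univ _) (le_sup_left : m ≤ m ⊔ a))⟩
  obtain ⟨u, hu, hu'⟩ := exists_ext (fun a b : L => Lft f o i a b) (fun a b h => ⟨h.1, h.2.1⟩)
    (fun a b x y => hd.total ho hi x y) (fun a b x y => hd.asymm ho hi x y)
    (fun a b c x y => hd.trans ho hi x y)
  obtain ⟨v, hv, hv'⟩ := exists_ext (fun a b : L => Lft f o i b a) (fun a b h => ⟨h.2.1, h.1⟩)
    (fun a b x y => (hd.total ho hi x y).symm) (fun a b x y => hd.asymm ho hi x y)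
    (fun a b c x y => hd.trans ho hi y x)
  refine ⟨u, v, hu, hv, ?_⟩
  intro a b x y
  by_contra hab
  by_cases hba : b ≤ a
  · have : b < a := lt_of_le_not_ge hba hab
    linarith [hu _ _ this]
  · rcases hd.total ho hi hab hba with h | h
    · linarith [hv' _ _ h]
    · linarith [hu' _ _ h]

end PlanarAux

/-- A finite lattice that order-embeds into a finite planar lattice is itself planar. -/
theorem planar_of_orderEmbedding {L K : Type*} [Lattice L] [Finite L] [Lattice K] [Finite K]
    (hL : IsPlanarLattice L) (f : K → L) (hf : ∀ p q : K, p ≤ q ↔ f p ≤ f q) :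
    IsPlanarLattice K := by
  by_cases hK : Nonempty K
  · obtain ⟨k⟩ := hK
    have : Nonempty L := ⟨f k⟩
    obtain ⟨u, v, hu, hv, huv⟩ := PlanarAux.coords_of_planar hL
    have hlt : ∀ a b : K, a < b → f a < f b := by
      intro a b h
      rw [lt_iff_le_not_ge, ← hf, ← hf]
      exact ⟨h.le, h.not_ge⟩
    exact PlanarAux.planar_of_coords (u ∘ f) (v ∘ f) (fun a b h => hu _ _ (hlt a b h))
      (fun a b h => hv _ _ (hlt a b h)) (fun a b x y => (hf a b).2 (huv _ _ x y))
  · have hE : IsEmpty K := not_nonempty_iff.1 hK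
    exact PlanarAux.planar_of_coords (fun _ => 0) (fun _ => 0) (fun a => hE.elim a)
      (fun a => hE.elim a) (fun a => hE.elim a)
end
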